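/- arXiv:2503.08488 — 4 statements merged into one kernel-verified Lean document; each statement's English description precedes it below -/
import Mathlib

section
/- At the critical inverse temperature, the averaged infinite-volume free-boundary two-point function of the three-dimensional nearest-neighbor XY model vanishes: lim_{n→∞} (1/|B_n|²) Σ_{x,y ∈ B_n} ⟨S_x·S_y⟩_{0,β_c} = 0. -/
open MeasureTheory Real Filter

noncomputable section

abbrev Site : Type := Fin 3 → ℤ

/-- Nearest-neighbor adjacency on `ℤ³`. -/
def adj (k l : Site) : Prop := (∑ i, |k i - l i|) = 1

instance (k l : Site) : Decidable (adj k l) := by unfold adj; infer_instance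

/-- The interior `Λ_L° = ((-L,L) ∩ ℤ)³`. -/
def interF (L : ℕ) : Finset Site := Finset.Icc (fun _ => -(L : ℤ) + 1) (fun _ => (L : ℤ) - 1)

/-- The box `Λ_L = ([-L,L] ∩ ℤ)³`. -/
def lamF (L : ℕ) : Finset Site := Finset.Icc (fun _ => -(L : ℤ)) (fun _ => (L : ℤ))

/-- Configurations of angles on the interior of `Λ_L`. -/
abbrev Cfg (L : ℕ) : Type := ↥(interF L) → ℝ

/-- The cube `[0,2π]^{Λ_L°}`. -/
def cube (L : ℕ) : Set (Cfg L) := Set.univ.pi fun _ => Set.Icc 0 (2 * π)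

/-- Evaluation of a configuration at a site (`0` outside the interior). -/
def val (L : ℕ) (θ : Cfg L) (x : Site) : ℝ := if h : x ∈ interF L then θ ⟨x, h⟩ else 0

/-- Free-boundary energy `(β/6) Σ_{k,l ∈ Λ_L°, |k-l|=1} cos(θ_k - θ_l)`. -/
def energy0 (L : ℕ) (β : ℝ) (θ : Cfg L) : ℝ :=
  β / 6 * ∑ k : ↥(interF L), ∑ l : ↥(interF L),
    if adj k.1 l.1 then Real.cos (θ k - θ l) else 0

/-- `N_∂(k)`, the number of boundary neighbors of `k`. -/
def nBd (L : ℕ) (k : Site) : ℕ := ((lamF L \ interF L).filter fun l => adj k l).card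

/-- Plus-boundary energy. -/
def energyP (L : ℕ) (β : ℝ) (θ : Cfg L) : ℝ :=
  energy0 L β θ + β / 3 * ∑ k : ↥(interF L), (nBd L k.1 : ℝ) * Real.cos (θ k)

/-- Free-boundary expectation `⟨F⟩_{L,0,β}`. -/
def avg0 (L : ℕ) (β : ℝ) (F : Cfg L → ℝ) : ℝ :=
  (∫ θ in cube L, F θ * Real.exp (energy0 L β θ)) / ∫ θ in cube L, Real.exp (energy0 L β θ)

/-- Plus-boundary expectation `⟨F⟩_{L,+,β}`. -/
def avgP (L : ℕ) (β : ℝ) (F : Cfg L → ℝ) : ℝ :=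
  (∫ θ in cube L, F θ * Real.exp (energyP L β θ)) / ∫ θ in cube L, Real.exp (energyP L β θ)

/-- Free-boundary two-point function `⟨cos(θ_x - θ_y)⟩_{L,0,β}`. -/
def corr0 (L : ℕ) (β : ℝ) (x y : Site) : ℝ :=
  avg0 L β fun θ => Real.cos (val L θ x - val L θ y)

/-- Plus-boundary two-point function `⟨cos(θ_x - θ_y)⟩_{L,+,β}`. -/
def corrPlus (L : ℕ) (β : ℝ) (x y : Site) : ℝ :=
  avgP L β fun θ => Real.cos (val L θ x - val L θ y)

/-- Finite-volume plus-boundary magnetization at site `y`. -/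
def magAt (L : ℕ) (β : ℝ) (y : Site) : ℝ := avgP L β fun θ => Real.cos (val L θ y)

/-- The spontaneous magnetization `m*(β) = inf_{L ≥ 2} ⟨cos θ_0⟩_{L,+,β}`. -/
def mStar (β : ℝ) : ℝ := sInf {r : ℝ | ∃ L : ℕ, 2 ≤ L ∧ r = magAt L β 0}

/-- The critical inverse temperature `β_c`. -/
def critBeta : ℝ := sSup {β : ℝ | 0 < β ∧ mStar β = 0}

/-- Sup-norm on `ℤ³`. -/
def supNorm (x : Site) : ℤ := max |x 0| (max |x 1| |x 2|)

/-- Infinite-volume free-boundary two-point function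
`⟨S_x·S_y⟩_{0,β} = sup_{L > max(‖x‖∞,‖y‖∞)} ⟨cos(θ_x - θ_y)⟩_{L,0,β}`. -/
def S20 (β : ℝ) (x y : Site) : ℝ :=
  sSup {r : ℝ | ∃ L : ℕ, max (supNorm x) (supNorm y) < (L : ℤ) ∧ r = corr0 L β x y}

/-- The box `B_n = {z ∈ ℤ³ : max |z_i| ≤ n}`. -/
def Bn (n : ℕ) : Finset Site := Finset.Icc (fun _ => -(n : ℤ)) (fun _ => (n : ℤ))

/-- Fundamental domain `{-L,…,L-1}³` for the torus `T_L = (ℤ/2Lℤ)³`. -/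
def torF (L : ℕ) : Finset Site := Finset.Icc (fun _ => -(L : ℤ)) (fun _ => (L : ℤ) - 1)

/-- Distance on `ℤ/2Lℤ`. -/
def torDist (L : ℕ) (m : ℤ) : ℤ := min (m % (2 * (L : ℤ))) (2 * (L : ℤ) - m % (2 * (L : ℤ)))

/-- Graph adjacency on the torus `T_L`. -/
def adjT (L : ℕ) (k l : Site) : Prop := (∑ i, torDist L (k i - l i)) = 1

instance (L : ℕ) (k l : Site) : Decidable (adjT L k l) := by unfold adjT; infer_instance

abbrev TCfg (L : ℕ) : Type := ↥(torF L) → ℝ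

def cubeT (L : ℕ) : Set (TCfg L) := Set.univ.pi fun _ => Set.Icc 0 (2 * π)

def valT (L : ℕ) (θ : TCfg L) (x : Site) : ℝ := if h : x ∈ torF L then θ ⟨x, h⟩ else 0

/-- Periodic-boundary energy on the torus `T_L`. -/
def energyT (L : ℕ) (β : ℝ) (θ : TCfg L) : ℝ :=
  β / 6 * ∑ k : ↥(torF L), ∑ l : ↥(torF L),
    if adjT L k.1 l.1 then Real.cos (θ k - θ l) else 0

/-- Periodic-boundary expectation `⟨F⟩_{L,P,β}`. -/
def avgT (L : ℕ) (β : ℝ) (F : TCfg L → ℝ) : ℝ :=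
  (∫ θ in cubeT L, F θ * Real.exp (energyT L β θ)) / ∫ θ in cubeT L, Real.exp (energyT L β θ)

/-- Periodic two-point function `⟨cos(θ_x - θ_y)⟩_{L,P,β}`. -/
def corrT (L : ℕ) (β : ℝ) (x y : Site) : ℝ :=
  avgT L β fun θ => Real.cos (valT L θ x - valT L θ y)

/-- `Ĵ(k) = (cos k₁ + cos k₂ + cos k₃)/3`. -/
def Jhat (k : Fin 3 → ℝ) : ℝ := (Real.cos (k 0) + Real.cos (k 1) + Real.cos (k 2)) / 3

/-- The cube `[-π,π]³`. -/
def Qpi : Set (Fin 3 → ℝ) := Set.univ.pi fun _ => Set.Icc (-π) π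

/-- The lattice Green-type function `G(v)`. -/
def green (v : Site) : ℝ :=
  ((2 * π) ^ 3)⁻¹ * ∫ k in Qpi, Real.cos (∑ i, k i * (v i : ℝ)) / (1 - Jhat k)

/-- `G(x,y) := G(x-y)`. -/
def greenXY (x y : Site) : ℝ := green (x - y)

end

noncomputable section

namespace XYModel

instance : Fact (0 < 2 * π) := ⟨two_pi_pos⟩

instance : CompactSpace Real.Angle := inferInstanceAs (CompactSpace (AddCircle (2 * π)))

instance : SecondCountableTopology Real.Angle :=
  inferInstanceAs (SecondCountableTopology (AddCircle (2 * π)))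

instance : MeasurableSpace Real.Angle := inferInstanceAs (MeasurableSpace (AddCircle (2 * π)))

instance : BorelSpace Real.Angle := inferInstanceAs (BorelSpace (AddCircle (2 * π)))

/-- The angles carry the Haar probability measure. -/
instance : MeasureSpace Real.Angle where
  volume := (AddCircle.haarAddCircle : Measure (AddCircle (2 * π)))

instance : (volume : Measure Real.Angle).IsAddHaarMeasure :=
  inferInstanceAs ((AddCircle.haarAddCircle : Measure (AddCircle (2 * π))).IsAddHaarMeasure)

instance : IsProbabilityMeasure (volume : Measure Real.Angle) :=
  inferInstanceAs (IsProbabilityMeasure (AddCircle.haarAddCircle : Measure (AddCircle (2 * π))))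

/-- Angle configurations on a vertex set. -/
abbrev Conf (V : Type*) : Type _ := V → Real.Angle

instance {V : Type*} [Fintype V] : (volume : Measure (Conf V)).IsAddHaarMeasure :=
  inferInstanceAs (Measure.pi fun _ : V => (volume : Measure Real.Angle)).IsAddHaarMeasure

instance {V W : Type*} [Fintype V] [Fintype W] :
    (volume : Measure (Conf V × Conf W)).IsAddHaarMeasure :=
  inferInstanceAs ((volume : Measure (Conf V)).prod (volume : Measure (Conf W))).IsAddHaarMeasure

section Haar

variable {G H : Type*} [AddCommGroup G] [TopologicalSpace G] [IsTopologicalAddGroup G]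
  [MeasurableSpace G] [BorelSpace G]
  [AddCommGroup H] [TopologicalSpace H] [IsTopologicalAddGroup H]
  [CompactSpace H] [MeasurableSpace H] [BorelSpace H]

theorem integral_comp_surjective {μ : Measure G} [μ.IsAddHaarMeasure] [IsProbabilityMeasure μ]
    {ν : Measure H} [ν.IsAddHaarMeasure] [IsProbabilityMeasure ν]
    (f : G →+ H) (hf : Continuous f) (hs : Function.Surjective f) {g : H → ℝ}
    (hg : Continuous g) : ∫ x, g (f x) ∂μ = ∫ y, g y ∂ν := by
  have h : MeasurePreserving f μ ν := f.measurePreserving hf hs (by simp)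
  rw [← h.map_eq, integral_map h.measurable.aemeasurable]
  exact hg.aestronglyMeasurable

end Haar

section SumDiff

variable {V : Type*} [Fintype V]

theorem integrable_of_continuous' {X : Type*} [TopologicalSpace X] [CompactSpace X]
    [SecondCountableTopology X] [MeasurableSpace X] [BorelSpace X]
    {μ : Measure X} [IsFiniteMeasure μ] {f : X → ℝ} (hf : Continuous f) : Integrable f μ :=
  hf.integrable_of_hasCompactSupport (HasCompactSupport.of_compactSpace f)

/-- The map `(φ, ψ) ↦ (φ + ψ, φ - ψ)`. -/
def sumDiff (G : Type*) [AddCommGroup G] : G × G →+ G × G where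
  toFun p := (p.1 + p.2, p.1 - p.2)
  map_zero' := by simp
  map_add' p q := by ext <;> simp <;> abel

theorem exists_half (α : Real.Angle) : ∃ γ : Real.Angle, γ + γ = α := by
  induction α using Real.Angle.induction_on with
  | _ r => exact ⟨((r / 2 : ℝ) : Real.Angle), by rw [← Real.Angle.coe_add, add_halves]⟩

theorem integral_sumDiff {g : Conf V × Conf V → ℝ} (hg : Continuous g) :
    ∫ p : Conf V × Conf V, g (p.1 + p.2, p.1 - p.2) = ∫ p : Conf V × Conf V, g p := by
  refine integral_comp_surjective (sumDiff (Conf V)) ?_ ?_ hg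
  · exact (continuous_fst.add continuous_snd).prodMk (continuous_fst.sub continuous_snd)
  · rintro ⟨a, b⟩
    choose c hc using fun v => exists_half (a v)
    choose d hd using fun v => exists_half (b v)
    refine ⟨(c + d, c - d), ?_⟩
    ext v
    · simp only [sumDiff, AddMonoidHom.coe_mk, ZeroHom.coe_mk, Pi.add_apply, Pi.sub_apply]
      rw [← hc]; abel
    · simp only [sumDiff, AddMonoidHom.coe_mk, ZeroHom.coe_mk, Pi.add_apply, Pi.sub_apply]
      rw [← hd]; abel

end SumDiff

theorem measurePreserving_coe_angle :
    MeasurePreserving (fun r : ℝ => (r : Real.Angle))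
      ((ENNReal.ofReal (2 * π))⁻¹ • (volume : Measure ℝ).restrict (Set.Icc 0 (2 * π))) volume := by
  have h := AddCircle.measurePreserving_mk (2 * π) 0
  have hv := AddCircle.volume_eq_smul_haarAddCircle (T := 2 * π)
  have h0 : ENNReal.ofReal (2 * π) ≠ 0 := by simpa using two_pi_pos
  refine ⟨h.measurable, ?_⟩
  rw [Measure.map_smul]
  have : (volume : Measure ℝ).restrict (Set.Icc 0 (2 * π))
      = volume.restrict (Set.Ioc 0 (0 + 2 * π)) := by
    rw [zero_add]; exact (Measure.restrict_congr_set Ioc_ae_eq_Icc).symm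
  rw [this]
  have h2 := h.map_eq
  rw [hv] at h2
  have h3 : (ENNReal.ofReal (2 * π))⁻¹ • (ENNReal.ofReal (2 * π) •
      (AddCircle.haarAddCircle : Measure (AddCircle (2 * π)))) = AddCircle.haarAddCircle := by
    rw [smul_smul, ENNReal.inv_mul_cancel h0 ENNReal.ofReal_ne_top, one_smul]
  exact (congrArg (fun m => (ENNReal.ofReal (2 * π))⁻¹ • m) h2).trans h3

theorem integral_cube {V : Type*} [Fintype V] {g : Conf V → ℝ} (hg : Continuous g) :
    ∫ θ in Set.univ.pi (fun _ : V => Set.Icc 0 (2 * π)), g (fun v => (θ v : Real.Angle))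
      = (2 * π) ^ Fintype.card V * ∫ θ, g θ := by
  have h1 : MeasurePreserving (fun (θ : V → ℝ) v => ((θ v : ℝ) : Real.Angle))
      (Measure.pi fun _ : V =>
        (ENNReal.ofReal (2 * π))⁻¹ • (volume : Measure ℝ).restrict (Set.Icc 0 (2 * π))) volume := by
    have : IsFiniteMeasure
        ((ENNReal.ofReal (2 * π))⁻¹ • (volume : Measure ℝ).restrict (Set.Icc 0 (2 * π))) :=
      Measure.smul_finite _ (by simpa using two_pi_pos)
    exact measurePreserving_pi _ _ fun _ => measurePreserving_coe_angle
  have h2 : (Measure.pi fun _ : V =>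
        (ENNReal.ofReal (2 * π))⁻¹ • (volume : Measure ℝ).restrict (Set.Icc 0 (2 * π)))
      = ((ENNReal.ofReal (2 * π))⁻¹ ^ Fintype.card V) •
        (volume : Measure (V → ℝ)).restrict (Set.univ.pi (fun _ : V => Set.Icc 0 (2 * π))) := by
    have : IsFiniteMeasure
        ((ENNReal.ofReal (2 * π))⁻¹ • (volume : Measure ℝ).restrict (Set.Icc 0 (2 * π))) :=
      Measure.smul_finite _ (by simpa using two_pi_pos)
    refine (Measure.pi_eq fun s hs => ?_)
    rw [volume_pi, Measure.restrict_pi_pi, Measure.smul_apply, Measure.pi_pi]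
    simp only [Measure.smul_apply, smul_eq_mul, Finset.prod_mul_distrib, Finset.prod_const]
    rfl
  rw [← h1.map_eq, integral_map h1.measurable.aemeasurable hg.aestronglyMeasurable, h2,
    integral_smul_measure, ENNReal.toReal_pow, ENNReal.toReal_inv,
    ENNReal.toReal_ofReal two_pi_pos.le, smul_eq_mul, ← mul_assoc, ← mul_pow,
    mul_inv_cancel₀ two_pi_pos.ne', one_pow, one_mul]

/-- Cauchy-Schwarz for quadratic forms, via the discriminant. -/
theorem sq_le_mul_of_forall_quadratic {A B D : ℝ} (h : ∀ s : ℝ, 0 ≤ A * (s * s) + 2 * B * s + D) :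
    B ^ 2 ≤ A * D := by
  have := discrim_le_zero h
  rw [discrim] at this
  nlinarith

section Kernel

variable {X I : Type*} [TopologicalSpace X] [CompactSpace X] [SecondCountableTopology X]
  [MeasurableSpace X] [BorelSpace X] {μ : Measure X} [IsFiniteMeasure μ] [Fintype I]

/-- The `n`-th term of the expansion of a kernel integral. -/
def kernelTerm (μ : Measure X) (w : I → ℝ) (F G : X → ℝ) (c d : I → X → ℝ) (n : ℕ) : ℝ :=
  (n.factorial : ℝ)⁻¹ * ∑ q : Fin n → I, (∏ j, w (q j)) *
    ((∫ x, F x * ∏ j, c (q j) x ∂μ) * ∫ y, G y * ∏ j, d (q j) y ∂μ)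

theorem hasSum_kernelTerm (w : I → ℝ) {F G : X → ℝ} {c d : I → X → ℝ} (hF : Continuous F)
    (hG : Continuous G) (hc : ∀ i, Continuous (c i)) (hd : ∀ i, Continuous (d i)) :
    HasSum (kernelTerm μ w F G c d)
      (∫ p : X × X, F p.1 * G p.2 * Real.exp (∑ i, w i * (c i p.1 * d i p.2)) ∂(μ.prod μ)) := by
  set K : X × X → ℝ := fun p => ∑ i, w i * (c i p.1 * d i p.2) with hK
  have hKc : Continuous K := by fun_prop
  set f : ℕ → X × X → ℝ := fun n p => F p.1 * G p.2 * ((n.factorial : ℝ)⁻¹ * K p ^ n) with hf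
  have hfc : ∀ n, Continuous (f n) := fun n => by fun_prop
  obtain ⟨M, hM⟩ := isCompact_univ.exists_bound_of_continuousOn hKc.continuousOn
  obtain ⟨C, hC⟩ := isCompact_univ.exists_bound_of_continuousOn
    (show Continuous fun p : X × X => F p.1 * G p.2 by fun_prop).continuousOn
  have hterm : ∀ n, ∫ p, f n p ∂(μ.prod μ) = kernelTerm μ w F G c d n := by
    intro n
    have : ∀ p : X × X, f n p = (n.factorial : ℝ)⁻¹ * ∑ q : Fin n → I, (∏ j, w (q j)) *
        ((F p.1 * ∏ j, c (q j) p.1) * (G p.2 * ∏ j, d (q j) p.2)) := by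
      intro p
      simp only [hf, hK, Fintype.sum_pow, Finset.mul_sum, Finset.prod_mul_distrib]
      exact Finset.sum_congr rfl fun q _ => by ring
    simp_rw [this]
    rw [integral_const_mul, integral_finsetSum]
    · simp_rw [integral_const_mul]
      rw [kernelTerm]
      congr 1
      refine Finset.sum_congr rfl fun q _ => ?_
      rw [integral_prod_mul (fun x => F x * ∏ j, c (q j) x) (fun y => G y * ∏ j, d (q j) y)]
    · intro q _
      exact integrable_of_continuous' (by fun_prop)
  have hsum : ∀ p, HasSum (fun n => f n p) (F p.1 * G p.2 * Real.exp (K p)) := by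
    intro p
    refine HasSum.mul_left _ ?_
    have := NormedSpace.expSeries_div_hasSum_exp (𝔸 := ℝ) (K p)
    rw [← Real.exp_eq_exp_ℝ] at this
    simpa [div_eq_inv_mul] using this
  have key := hasSum_integral_of_summable_integral_norm (μ := μ.prod μ) (F := f)
    (fun n => integrable_of_continuous' (hfc n)) ?_
  · simp_rw [hterm] at key
    have e : ∫ p : X × X, F p.1 * G p.2 * Real.exp (K p) ∂(μ.prod μ)
        = ∫ p, ∑' n, f n p ∂(μ.prod μ) :=
      integral_congr_ae (ae_of_all _ fun p => (hsum p).tsum_eq.symm)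
    rw [e]
    exact key
  · refine Summable.of_nonneg_of_le (fun n => integral_nonneg fun _ => norm_nonneg _)
      (fun n => ?_) (((Real.summable_pow_div_factorial M).mul_left C).mul_left
        ((μ.prod μ).real Set.univ))
    calc ∫ p, ‖f n p‖ ∂(μ.prod μ) ≤ ∫ _p, C * (M ^ n / n.factorial) ∂(μ.prod μ) := by
          refine integral_mono_ae (integrable_of_continuous' (hfc n).norm) (integrable_const _)
            (ae_of_all _ fun p => ?_)
          have h1 := hM p (Set.mem_univ _)
          have h2 := hC p (Set.mem_univ _)
          simp only [hf, norm_mul, norm_pow, norm_inv, RCLike.norm_natCast] at h2 ⊢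
          rw [div_eq_inv_mul]
          have : (0:ℝ) ≤ C := le_trans (by positivity) h2
          gcongr
      _ = _ := by simp [mul_comm]

theorem kernel_cauchy_schwarz {w : I → ℝ} (hw : ∀ i, 0 ≤ w i) {F G : X → ℝ} {c d : I → X → ℝ}
    (hF : Continuous F) (hG : Continuous G) (hc : ∀ i, Continuous (c i))
    (hd : ∀ i, Continuous (d i)) :
    (∫ p : X × X, F p.1 * G p.2 * Real.exp (∑ i, w i * (c i p.1 * d i p.2)) ∂(μ.prod μ)) ^ 2 ≤
      (∫ p : X × X, F p.1 * F p.2 * Real.exp (∑ i, w i * (c i p.1 * c i p.2)) ∂(μ.prod μ)) *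
      ∫ p : X × X, G p.1 * G p.2 * Real.exp (∑ i, w i * (d i p.1 * d i p.2)) ∂(μ.prod μ) := by
  refine sq_le_mul_of_forall_quadratic fun s => ?_
  have h1 := (hasSum_kernelTerm (μ := μ) w hF hF hc hc).mul_right (s * s)
  have h2 := ((hasSum_kernelTerm (μ := μ) w hF hG hc hd).mul_left 2).mul_right s
  have h3 := hasSum_kernelTerm (μ := μ) w hG hG hd hd
  refine ((h1.add h2).add h3).nonneg fun n => ?_
  simp only [kernelTerm]
  have : ∀ (a : ℝ) (x y z : (Fin n → I) → ℝ), a * (∑ q, x q) * (s * s) + 2 * (a * ∑ q, y q) * s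
      + a * ∑ q, z q = a * ∑ q, (x q * (s * s) + 2 * y q * s + z q) := by
    intro a x y z
    simp only [Finset.sum_add_distrib, ← Finset.sum_mul, ← Finset.mul_sum]; ring
  rw [this]
  refine mul_nonneg (by positivity) (Finset.sum_nonneg fun q _ => ?_)
  have hp : 0 ≤ ∏ j, w (q j) := Finset.prod_nonneg fun j _ => hw _
  set a := ∫ x, F x * ∏ j, c (q j) x ∂μ
  set b := ∫ x, G x * ∏ j, d (q j) x ∂μ
  nlinarith [mul_nonneg hp (sq_nonneg (a * s + b))]

theorem kernel_nonneg {w : I → ℝ} (hw : ∀ i, 0 ≤ w i) {F : X → ℝ} {c : I → X → ℝ}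
    (hF : Continuous F) (hc : ∀ i, Continuous (c i)) :
    0 ≤ ∫ p : X × X, F p.1 * F p.2 * Real.exp (∑ i, w i * (c i p.1 * c i p.2)) ∂(μ.prod μ) := by
  refine (hasSum_kernelTerm (μ := μ) w hF hF hc hc).nonneg fun n => ?_
  exact mul_nonneg (by positivity) (Finset.sum_nonneg fun q _ =>
    mul_nonneg (Finset.prod_nonneg fun j _ => hw _) (mul_self_nonneg _))

end Kernel

@[fun_prop]
theorem continuous_angle_cos : Continuous Real.Angle.cos := Real.Angle.continuous_cos

@[fun_prop]
theorem continuous_angle_sin : Continuous Real.Angle.sin := Real.Angle.continuous_sin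

theorem angle_cos_sub (u v : Real.Angle) :
    (u - v).cos = u.cos * v.cos + u.sin * v.sin := by
  rw [sub_eq_add_neg, Real.Angle.cos_add, Real.Angle.cos_neg, Real.Angle.sin_neg]; ring

section Glue

variable {V : Type*} [DecidableEq V] (W : Finset V)

/-- The configuration equal to `θ` on `W` and to `α` off `W`. -/
def glue (θ α : Conf V) : Conf V := fun x => if x ∈ W then θ x else α x

@[fun_prop]
theorem continuous_glue : Continuous fun p : Conf V × Conf V => glue W p.1 p.2 := by
  refine continuous_pi fun x => ?_
  by_cases h : x ∈ W <;> simp only [glue, h, if_true, if_false] <;> fun_prop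

theorem continuous_glue_left (α : Conf V) : Continuous fun θ => glue W θ α :=
  (continuous_glue W).comp (by fun_prop : Continuous fun θ : Conf V => (θ, α))

theorem glue_add (θ α θ' α' : Conf V) : glue W (θ + θ') (α + α') = glue W θ α + glue W θ' α' := by
  ext x; by_cases h : x ∈ W <;> simp [glue, h]

theorem glue_sub (θ α θ' α' : Conf V) : glue W (θ - θ') (α - α') = glue W θ α - glue W θ' α' := by
  ext x; by_cases h : x ∈ W <;> simp [glue, h]

end Glue

variable {V : Type*} [Fintype V]

theorem integral_prod_conf {f g : Conf V → ℝ} :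
    ∫ p : Conf V × Conf V, f p.1 * g p.2 = (∫ θ, f θ) * ∫ θ, g θ :=
  integral_prod_mul f g

/-- Ginibre's inequality, in the form obtained by duplicating variables. -/
theorem ginibre {I : Type*} [Fintype I] {w : I → ℝ} (hw : ∀ i, 0 ≤ w i) {c : I → Conf V → ℝ}
    (hc : ∀ i, Continuous (c i)) {H₁ H₂ f₁ f₂ g : Conf V → ℝ} (hH₁ : Continuous H₁)
    (hH₂ : Continuous H₂) (hf₁ : Continuous f₁) (hf₂ : Continuous f₂) (hg : Continuous g) (k : ℝ)
    (hH : ∀ φ ψ, H₁ (φ + ψ) + H₂ (φ - ψ) = k + ∑ i, w i * (c i φ * c i ψ))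
    (hf : ∀ φ ψ, f₂ (φ - ψ) - f₁ (φ + ψ) = 2 * (g φ * g ψ)) :
    (∫ θ, f₁ θ * Real.exp (H₁ θ)) * (∫ θ, Real.exp (H₂ θ)) ≤
      (∫ θ, Real.exp (H₁ θ)) * ∫ θ, f₂ θ * Real.exp (H₂ θ) := by
  rw [← sub_nonneg, ← integral_prod_conf, ← integral_prod_conf, ← integral_sub
    (integrable_of_continuous' (by fun_prop)) (integrable_of_continuous' (by fun_prop)),
    ← integral_sumDiff (by fun_prop)]
  have : ∀ p : Conf V × Conf V, Real.exp (H₁ (p.1 + p.2)) * (f₂ (p.1 - p.2) *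
        Real.exp (H₂ (p.1 - p.2))) - f₁ (p.1 + p.2) * Real.exp (H₁ (p.1 + p.2)) *
        Real.exp (H₂ (p.1 - p.2))
      = (2 * Real.exp k) * (g p.1 * g p.2 * Real.exp (∑ i, w i * (c i p.1 * c i p.2))) := by
    intro p
    calc _ = (f₂ (p.1 - p.2) - f₁ (p.1 + p.2)) *
          Real.exp (H₁ (p.1 + p.2) + H₂ (p.1 - p.2)) := by rw [Real.exp_add]; ring
      _ = _ := by rw [hf, hH, Real.exp_add]; ring
  simp_rw [this]
  rw [integral_const_mul]
  exact mul_nonneg (by positivity) (kernel_nonneg hw hg hc)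

/-- The XY energy with pair couplings `J`. -/
def energy (J : V → V → ℝ) (θ : Conf V) : ℝ := ∑ x, ∑ y, J x y * (θ x - θ y).cos

@[fun_prop]
theorem continuous_energy (J : V → V → ℝ) : Continuous (energy J) := by
  unfold energy; fun_prop

theorem cos_sub_cos_duplicate (u v : Real.Angle) :
    (u - v).cos - (u + v).cos = 2 * (u.sin * v.sin) := by
  rw [angle_cos_sub, Real.Angle.cos_add]; ring

/-- Two-point functions increase with the couplings. -/
theorem ginibre_mono {J J' : V → V → ℝ} (h0 : ∀ x y, 0 ≤ J x y) (h : ∀ x y, J x y ≤ J' x y)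
    (a b : V) :
    (∫ θ : Conf V, (θ a - θ b).cos * Real.exp (energy J θ)) *
        (∫ θ : Conf V, Real.exp (energy J' θ)) ≤
      (∫ θ : Conf V, Real.exp (energy J θ)) *
        ∫ θ : Conf V, (θ a - θ b).cos * Real.exp (energy J' θ) := by
  refine ginibre (I := (V × V) ⊕ (V × V))
    (w := Sum.elim (fun e => J e.1 e.2 + J' e.1 e.2) fun e => J' e.1 e.2 - J e.1 e.2)
    (c := Sum.elim (fun e θ => (θ e.1 - θ e.2).cos) fun e θ => (θ e.1 - θ e.2).sin)
    ?_ ?_ (by fun_prop) (by fun_prop) (by fun_prop) (by fun_prop)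
    (g := fun θ => (θ a - θ b).sin) (by fun_prop) 0 ?_ ?_
  · rintro (e | e)
    · exact add_nonneg (h0 _ _) ((h0 _ _).trans (h _ _))
    · exact sub_nonneg.2 (h _ _)
  · rintro (e | e) <;> simp only [Sum.elim_inl, Sum.elim_inr] <;> fun_prop
  · intro φ ψ
    simp only [energy, Fintype.sum_sum_type, Sum.elim_inl, Sum.elim_inr, Fintype.sum_prod_type,
      ← Finset.sum_add_distrib, zero_add]
    refine Finset.sum_congr rfl fun x _ => Finset.sum_congr rfl fun y _ => ?_
    rw [show (φ + ψ) x - (φ + ψ) y = (φ x - φ y) + (ψ x - ψ y) by simp only [Pi.add_apply]; abel,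
      show (φ - ψ) x - (φ - ψ) y = (φ x - φ y) - (ψ x - ψ y) by simp only [Pi.sub_apply]; abel,
      angle_cos_sub (φ x - φ y), Real.Angle.cos_add]
    ring
  · intro φ ψ
    rw [show (φ + ψ) a - (φ + ψ) b = (φ a - φ b) + (ψ a - ψ b) by simp only [Pi.add_apply]; abel,
      show (φ - ψ) a - (φ - ψ) b = (φ a - φ b) - (ψ a - ψ b) by simp only [Pi.sub_apply]; abel]
    exact cos_sub_cos_duplicate _ _

section Pinned

variable [DecidableEq V] (W : Finset V)

theorem integral_glue {g : Conf V → ℝ} (hg : Continuous g) :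
    ∫ α, ∫ θ, g (glue W θ α) = ∫ θ, g θ := by
  have h1 : ∫ p : Conf V × Conf V, g (glue W p.2 p.1) = ∫ θ, g θ :=
    integral_comp_surjective
      (f := { toFun := fun p : Conf V × Conf V => glue W p.2 p.1
              map_zero' := by ext x; simp [glue]
              map_add' := fun p q => glue_add W _ _ _ _ })
      ((continuous_glue W).comp continuous_swap)
      (fun θ => ⟨(θ, θ), by ext x; simp [glue]⟩) hg
  rw [← h1]
  symm
  exact integral_prod (fun p : Conf V × Conf V => g (glue W p.2 p.1))
    (integrable_of_continuous' (hg.comp ((continuous_glue W).comp continuous_swap)))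

theorem pinned_le {J : V → V → ℝ} (h0 : ∀ x y, 0 ≤ J x y) {a b : V} (ha : a ∈ W) (hb : b ∉ W)
    (α : Conf V) :
    (∫ θ, (glue W θ α a - glue W θ α b).cos * Real.exp (energy J (glue W θ α))) *
        (∫ θ, Real.exp (energy J (glue W θ 0))) ≤
      (∫ θ, Real.exp (energy J (glue W θ α))) *
        ∫ θ, (θ a).cos * Real.exp (energy J (glue W θ 0)) := by
  choose γ hγ using fun v => exists_half (α v)
  have hα : α = γ + γ := by ext v; simp [hγ]
  have h00 : (0 : Conf V) = γ - γ := by simp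
  have c0 := continuous_glue_left W (0 : Conf V)
  have c1 := continuous_glue_left W α
  have c2 := continuous_glue_left W γ
  have c2' : ∀ x, Continuous fun θ => glue W θ γ x := fun x => (continuous_apply x).comp c2
  have c1' : ∀ x, Continuous fun θ => glue W θ α x := fun x => (continuous_apply x).comp c1
  refine ginibre (I := V × V) (w := fun e => 2 * J e.1 e.2)
    (c := fun e θ => (glue W θ γ e.1 - glue W θ γ e.2).cos)
    (fun e => mul_nonneg zero_le_two (h0 _ _)) (fun e => by fun_prop) (by fun_prop) (by fun_prop)
    (by fun_prop) (by fun_prop) (g := fun θ => (glue W θ γ a - glue W θ γ b).sin)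
    (by fun_prop) 0 ?_ ?_
  · intro φ ψ
    rw [h00, hα, glue_add, glue_sub]
    simp only [energy, Fintype.sum_prod_type, ← Finset.sum_add_distrib, zero_add]
    refine Finset.sum_congr rfl fun x _ => Finset.sum_congr rfl fun y _ => ?_
    generalize glue W φ γ = φ
    generalize glue W ψ γ = ψ
    rw [show (φ + ψ) x - (φ + ψ) y = (φ x - φ y) + (ψ x - ψ y) by simp only [Pi.add_apply]; abel,
      show (φ - ψ) x - (φ - ψ) y = (φ x - φ y) - (ψ x - ψ y) by simp only [Pi.sub_apply]; abel,
      angle_cos_sub (φ x - φ y), Real.Angle.cos_add]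
    ring
  · intro φ ψ
    have : ((φ - ψ) a) = glue W (φ - ψ) (γ - γ) a - glue W (φ - ψ) (γ - γ) b := by
      simp [glue, ha, hb]
    rw [this, hα, glue_add, glue_sub]
    generalize glue W φ γ = φ
    generalize glue W ψ γ = ψ
    rw [show (φ + ψ) a - (φ + ψ) b = (φ a - φ b) + (ψ a - ψ b) by simp only [Pi.add_apply]; abel,
      show (φ - ψ) a - (φ - ψ) b = (φ a - φ b) - (ψ a - ψ b) by simp only [Pi.sub_apply]; abel]
    exact cos_sub_cos_duplicate _ _

/-- Pinning all spins off `W` to the angle `0` increases the correlation of a spin in `W` with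
a spin off `W`. -/
theorem two_point_le_pinned {J : V → V → ℝ} (h0 : ∀ x y, 0 ≤ J x y) {a b : V} (ha : a ∈ W)
    (hb : b ∉ W) :
    (∫ θ : Conf V, (θ a - θ b).cos * Real.exp (energy J θ)) *
        (∫ θ, Real.exp (energy J (glue W θ 0))) ≤
      (∫ θ, Real.exp (energy J θ)) * ∫ θ, (θ a).cos * Real.exp (energy J (glue W θ 0)) := by
  rw [← integral_glue W (g := fun θ => (θ a - θ b).cos * Real.exp (energy J θ)) (by fun_prop),
    ← integral_glue W (g := fun θ => Real.exp (energy J θ)) (by fun_prop),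
    ← integral_mul_const, ← integral_mul_const]
  have hint : ∀ g : Conf V → ℝ, Continuous g →
      Integrable (fun α : Conf V => ∫ θ : Conf V, g (glue W θ α)) := fun g hg =>
    (integrable_of_continuous' (μ := (volume : Measure (Conf V)).prod volume)
      (hg.comp ((continuous_glue W).comp continuous_swap))).integral_prod_left
  exact integral_mono
    ((hint (fun θ => (θ a - θ b).cos * Real.exp (energy J θ)) (by fun_prop)).mul_const _)
    ((hint (fun θ => Real.exp (energy J θ)) (by fun_prop)).mul_const _)
    fun α => pinned_le W h0 ha hb α

end Pinned

/-- Squared distance of two unit spins, after shifting the difference along the first axis. -/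
def shiftedSq (u v : Real.Angle) (h : ℝ) : ℝ := (u.cos - v.cos + h) ^ 2 + (u.sin - v.sin) ^ 2

section InnerEnergy

variable {V : Type*} {L : Finset V}

/-- The part of the energy coming from the pairs inside `L`. -/
def innerEnergy (J : V → V → ℝ) (L : Finset V) (h : V × V → ℝ) (θ : Conf V) : ℝ :=
  -(1 / 2) * ∑ x ∈ L, ∑ y ∈ L, J x y * shiftedSq (θ x) (θ y) (h (x, y))

@[fun_prop]
theorem continuous_innerEnergy (J : V → V → ℝ) (h : V × V → ℝ) :
    Continuous (innerEnergy J L h) := by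
  unfold innerEnergy shiftedSq
  fun_prop

theorem innerEnergy_congr {J : V → V → ℝ} {h h' : V × V → ℝ}
    (H : ∀ x ∈ L, ∀ y ∈ L, h (x, y) = h' (x, y)) :
    innerEnergy J L h = innerEnergy J L h' := by
  ext θ
  unfold innerEnergy
  congr 1
  exact Finset.sum_congr rfl fun x hx => Finset.sum_congr rfl fun y hy => by rw [H x hx y hy]

end InnerEnergy

variable {V : Type*} [Fintype V]

/-- The energy in a field `h` on the pairs of vertices. -/
def fieldEnergy (J : V → V → ℝ) (h : V × V → ℝ) (θ : Conf V) : ℝ :=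
  -(1 / 2) * ∑ x, ∑ y, J x y * shiftedSq (θ x) (θ y) (h (x, y))

/-- The partition function in a field `h` on the pairs of vertices. -/
def fieldZ (J : V → V → ℝ) (h : V × V → ℝ) : ℝ := ∫ θ : Conf V, Real.exp (fieldEnergy J h θ)

theorem continuous_fieldEnergy_uncurry (J : V → V → ℝ) :
    Continuous fun p : (V × V → ℝ) × Conf V => fieldEnergy J p.1 p.2 := by
  unfold fieldEnergy shiftedSq
  fun_prop

@[fun_prop]
theorem continuous_fieldEnergy (J : V → V → ℝ) (h : V × V → ℝ) :
    Continuous (fieldEnergy J h) := by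
  unfold fieldEnergy shiftedSq
  fun_prop

/-- A reflection of the vertex set leaving the couplings invariant, exchanging `L` with its
complement, such that couplings across only join a vertex with its mirror image. -/
structure IsReflection (J : V → V → ℝ) (ρ : V → V) (L : Finset V) : Prop where
  invol : ∀ x, ρ (ρ x) = x
  mem_iff : ∀ x, ρ x ∈ L ↔ x ∉ L
  coupling : ∀ x y, J (ρ x) (ρ y) = J x y
  cross : ∀ x y, (x ∈ L ↔ y ∉ L) → J x y ≠ 0 → y = ρ x

section Reflection

variable [DecidableEq V] {J : V → V → ℝ} {ρ : V → V} {L : Finset V}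

theorem IsReflection.sum_compl (hρ : IsReflection J ρ L) (f : V → ℝ) :
    ∑ x ∈ Lᶜ, f x = ∑ x ∈ L, f (ρ x) := by
  refine Finset.sum_nbij' ρ ρ ?_ ?_ ?_ ?_ ?_
  · intro x hx; exact (hρ.mem_iff x).2 (Finset.mem_compl.1 hx)
  · intro x hx; rw [Finset.mem_compl, hρ.mem_iff]; simpa using hx
  · intro x _; exact hρ.invol x
  · intro x _; exact hρ.invol x
  · intro x _; rw [hρ.invol]

/-- The configuration equal to `φ` on `L` and to the mirror image of `ψ` off `L`. -/
def fold (ρ : V → V) (L : Finset V) (φ ψ : Conf V) : Conf V :=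
  fun x => if x ∈ L then φ x else ψ (ρ x)

theorem IsReflection.integral_fold (hρ : IsReflection J ρ L) {g : Conf V → ℝ} (hg : Continuous g) :
    ∫ p : Conf V × Conf V, g (fold ρ L p.1 p.2) = ∫ θ, g θ := by
  refine integral_comp_surjective
      (f := { toFun := fun p : Conf V × Conf V => fold ρ L p.1 p.2
              map_zero' := by ext x; simp [fold]
              map_add' := fun p q => by ext x; by_cases h : x ∈ L <;> simp [fold, h] })
      ?_ (fun θ => ⟨(θ, fun x => θ (ρ x)), by ext x; simp [fold, hρ.invol]⟩) hg
  refine continuous_pi fun x => ?_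
  by_cases h : x ∈ L <;> simp only [fold, h, if_true, if_false, AddMonoidHom.coe_mk, ZeroHom.coe_mk]
    <;> fun_prop

theorem IsReflection.fieldEnergy_fold (hρ : IsReflection J ρ L) (h : V × V → ℝ) (φ ψ : Conf V) :
    fieldEnergy J h (fold ρ L φ ψ) = innerEnergy J L h φ +
      innerEnergy J L (fun e => h (ρ e.1, ρ e.2)) ψ + ∑ x ∈ L, -(1 / 2) * (J x (ρ x) *
        (shiftedSq (φ x) (ψ x) (h (x, ρ x)) + shiftedSq (ψ x) (φ x) (h (ρ x, x)))) := by
  have hin : ∀ x ∈ L, fold ρ L φ ψ x = φ x := fun x hx => by simp [fold, hx]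
  have hout : ∀ x ∈ L, fold ρ L φ ψ (ρ x) = ψ x := fun x hx => by
    have : ρ x ∉ L := by rw [hρ.mem_iff]; simpa using hx
    simp [fold, this, hρ.invol]
  set t : V → V → ℝ := fun x y =>
    J x y * shiftedSq (fold ρ L φ ψ x) (fold ρ L φ ψ y) (h (x, y)) with ht
  have hLR : ∀ x ∈ L, ∑ y ∈ L, t x (ρ y) = t x (ρ x) := by
    intro x hx
    refine Finset.sum_eq_single_of_mem x hx fun y hy hyx => ?_
    by_contra hne
    refine hyx ?_
    have hJ : J x (ρ y) ≠ 0 := left_ne_zero_of_mul hne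
    have := hρ.cross x (ρ y) (by rw [hρ.mem_iff]; simp [hx, hy]) hJ
    rw [← hρ.invol y, this, hρ.invol]
  have hRL : ∀ x ∈ L, ∑ y ∈ L, t (ρ x) y = t (ρ x) x := by
    intro x hx
    refine Finset.sum_eq_single_of_mem x hx fun y hy hyx => ?_
    by_contra hne
    have hJ : J (ρ x) y ≠ 0 := left_ne_zero_of_mul hne
    have := hρ.cross (ρ x) y (by rw [hρ.mem_iff]; simp [hx, hy]) hJ
    rw [hρ.invol] at this
    exact hyx this
  have hsum : ∑ x, ∑ y, t x y = ∑ x ∈ L, ∑ y ∈ L, t x y + ∑ x ∈ L, ∑ y ∈ L, t (ρ x) (ρ y)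
      + ∑ x ∈ L, (t x (ρ x) + t (ρ x) x) := by
    have h1 : ∀ x, ∑ y, t x y = ∑ y ∈ L, t x y + ∑ y ∈ L, t x (ρ y) := fun x => by
      rw [← hρ.sum_compl, Finset.sum_add_sum_compl]
    simp_rw [h1]
    rw [← Finset.sum_add_sum_compl L, hρ.sum_compl]
    simp_rw [Finset.sum_add_distrib]
    rw [Finset.sum_congr rfl hLR, Finset.sum_congr rfl hRL]
    ring
  have e1 : ∑ x ∈ L, ∑ y ∈ L, t x y
      = ∑ x ∈ L, ∑ y ∈ L, J x y * shiftedSq (φ x) (φ y) (h (x, y)) :=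
    Finset.sum_congr rfl fun x hx => Finset.sum_congr rfl fun y hy => by
      simp only [ht, hin x hx, hin y hy]
  have e2 : ∑ x ∈ L, ∑ y ∈ L, t (ρ x) (ρ y)
      = ∑ x ∈ L, ∑ y ∈ L, J x y * shiftedSq (ψ x) (ψ y) (h (ρ x, ρ y)) :=
    Finset.sum_congr rfl fun x hx => Finset.sum_congr rfl fun y hy => by
      simp only [ht, hout x hx, hout y hy, hρ.coupling]
  have e3 : ∑ x ∈ L, (t x (ρ x) + t (ρ x) x) = ∑ x ∈ L, (J x (ρ x) *
        (shiftedSq (φ x) (ψ x) (h (x, ρ x)) + shiftedSq (ψ x) (φ x) (h (ρ x, x)))) :=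
    Finset.sum_congr rfl fun x hx => by
      have : J (ρ x) x = J x (ρ x) := by rw [← hρ.coupling, hρ.invol]
      simp only [ht, hin x hx, hout x hx, this]
      ring
  rw [fieldEnergy, innerEnergy, innerEnergy, ← Finset.mul_sum, hsum, e1, e2, e3]
  ring

/-- The field obtained from `h` by reflecting its restriction to `L`. -/
def reflectField (ρ : V → V) (L : Finset V) (h : V × V → ℝ) : V × V → ℝ := fun e =>
  if e.1 ∈ L ∧ e.2 ∈ L then h e
  else if e.1 ∉ L ∧ e.2 ∉ L then h (ρ e.1, ρ e.2) else 0

theorem IsReflection.fieldEnergy_fold_reflectField (hρ : IsReflection J ρ L) (h : V × V → ℝ)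
    (φ ψ : Conf V) :
    fieldEnergy J (reflectField ρ L h) (fold ρ L φ ψ) = innerEnergy J L h φ +
      innerEnergy J L h ψ + ∑ x ∈ L, -(1 / 2) * (J x (ρ x) *
        (shiftedSq (φ x) (ψ x) 0 + shiftedSq (ψ x) (φ x) 0)) := by
  rw [hρ.fieldEnergy_fold]
  have hn : ∀ x ∈ L, ρ x ∉ L := fun x hx => by rw [hρ.mem_iff]; simpa using hx
  congr 1
  · have h1 : innerEnergy J L (reflectField ρ L h) = innerEnergy J L h :=
      innerEnergy_congr fun x hx y hy => by simp [reflectField, hx, hy]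
    have h2 : innerEnergy J L (fun e => reflectField ρ L h (ρ e.1, ρ e.2)) = innerEnergy J L h :=
      innerEnergy_congr fun x hx y hy => by simp [reflectField, hn x hx, hn y hy, hρ.invol]
    rw [h1, h2]
  · refine Finset.sum_congr rfl fun x hx => ?_
    simp [reflectField, hn x hx, hx]

theorem IsReflection.fieldEnergy_fold_reflectField_compl (hρ : IsReflection J ρ L)
    (h : V × V → ℝ) (φ ψ : Conf V) :
    fieldEnergy J (reflectField ρ Lᶜ h) (fold ρ L φ ψ) =
      innerEnergy J L (fun e => h (ρ e.1, ρ e.2)) φ +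
      innerEnergy J L (fun e => h (ρ e.1, ρ e.2)) ψ + ∑ x ∈ L, -(1 / 2) * (J x (ρ x) *
        (shiftedSq (φ x) (ψ x) 0 + shiftedSq (ψ x) (φ x) 0)) := by
  rw [← hρ.fieldEnergy_fold_reflectField]
  congr 1
  ext ⟨x, y⟩
  by_cases hx : x ∈ L <;> by_cases hy : y ∈ L <;> simp [reflectField, hx, hy, hρ.invol]

/-- Reflection positivity. -/
theorem IsReflection.fieldZ_sq_le (hρ : IsReflection J ρ L) (hJ : ∀ x y, 0 ≤ J x y)
    (h : V × V → ℝ) :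
    fieldZ J h ^ 2 ≤ fieldZ J (reflectField ρ L h) * fieldZ J (reflectField ρ Lᶜ h) := by
  set w : V ⊕ V ⊕ V → ℝ := Sum.elim (fun x => if x ∈ L then J x (ρ x) else 0)
    (Sum.elim (fun x => if x ∈ L then J x (ρ x) else 0)
      fun x => if x ∈ L then 2 * J x (ρ x) else 0) with hw
  set c : V ⊕ V ⊕ V → Conf V → ℝ := Sum.elim (fun x θ => (θ x).cos + h (x, ρ x))
    (Sum.elim (fun x θ => (θ x).cos - h (ρ x, x)) fun x θ => (θ x).sin) with hc
  set d : V ⊕ V ⊕ V → Conf V → ℝ := Sum.elim (fun x θ => (θ x).cos)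
    (Sum.elim (fun x θ => (θ x).cos) fun x θ => (θ x).sin) with hd
  set f : Conf V → ℝ := fun φ => innerEnergy J L h φ + ∑ x ∈ L, -(1 / 2) * (J x (ρ x) *
    (((φ x).cos + h (x, ρ x)) ^ 2 + ((φ x).cos - h (ρ x, x)) ^ 2 + 2 * (φ x).sin ^ 2)) with hf
  set g : Conf V → ℝ := fun φ => innerEnergy J L (fun e => h (ρ e.1, ρ e.2)) φ +
    ∑ x ∈ L, -(1 / 2) * (J x (ρ x) * (2 * (φ x).cos ^ 2 + 2 * (φ x).sin ^ 2)) with hg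
  have hfc : Continuous f := by fun_prop
  have hgc : Continuous g := by fun_prop
  have hw0 : ∀ i, 0 ≤ w i := by
    rintro (x | x | x) <;> simp only [hw, Sum.elim_inl, Sum.elim_inr] <;> split_ifs <;>
      first | exact le_rfl | exact hJ _ _ | exact mul_nonneg zero_le_two (hJ _ _)
  have hcc : ∀ i, Continuous (c i) := by
    rintro (x | x | x) <;> simp only [hc, Sum.elim_inl, Sum.elim_inr] <;> fun_prop
  have hdc : ∀ i, Continuous (d i) := by
    rintro (x | x | x) <;> simp only [hd, Sum.elim_inl, Sum.elim_inr] <;> fun_prop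
  have key := kernel_cauchy_schwarz (μ := (volume : Measure (Conf V))) hw0
    (F := fun φ => Real.exp (f φ)) (G := fun φ => Real.exp (g φ)) (by fun_prop) (by fun_prop)
    hcc hdc
  have hsplit : ∀ (a b : V ⊕ V ⊕ V → ℝ), ∑ i, w i * (a i * b i) =
      ∑ x ∈ L, J x (ρ x) * (a (.inl x) * b (.inl x) + a (.inr (.inl x)) * b (.inr (.inl x))
        + 2 * (a (.inr (.inr x)) * b (.inr (.inr x)))) := by
    intro a b
    simp only [Fintype.sum_sum_type, hw, Sum.elim_inl, Sum.elim_inr, ite_mul, zero_mul,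
      Finset.sum_ite_mem, Finset.univ_inter, ← Finset.sum_add_distrib]
    exact Finset.sum_congr rfl fun x _ => by ring
  have hadd : ∀ A B S F G K : ℝ, S = F + G + K → A + B + S = (A + F) + (B + G) + K := by
    intro A B S F G K h; rw [h]; ring
  have i1 : fieldZ J h = ∫ p : Conf V × Conf V, Real.exp (f p.1) * Real.exp (g p.2) *
      Real.exp (∑ i, w i * (c i p.1 * d i p.2)) := by
    rw [fieldZ, ← hρ.integral_fold (by fun_prop)]
    refine integral_congr_ae (ae_of_all _ fun p => ?_)
    simp only [← Real.exp_add]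
    rw [hρ.fieldEnergy_fold, hsplit]
    simp only [hf, hg, hc, hd, Sum.elim_inl, Sum.elim_inr]
    congr 1
    refine hadd _ _ _ _ _ _ ?_
    rw [← Finset.sum_add_distrib, ← Finset.sum_add_distrib]
    refine Finset.sum_congr rfl fun x _ => ?_
    simp only [shiftedSq]; ring
  have i2 : fieldZ J (reflectField ρ L h) = ∫ p : Conf V × Conf V, Real.exp (f p.1) *
      Real.exp (f p.2) * Real.exp (∑ i, w i * (c i p.1 * c i p.2)) := by
    rw [fieldZ, ← hρ.integral_fold (by fun_prop)]
    refine integral_congr_ae (ae_of_all _ fun p => ?_)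
    simp only [← Real.exp_add]
    rw [hρ.fieldEnergy_fold_reflectField, hsplit]
    simp only [hf, hc, Sum.elim_inl, Sum.elim_inr]
    congr 1
    refine hadd _ _ _ _ _ _ ?_
    rw [← Finset.sum_add_distrib, ← Finset.sum_add_distrib]
    refine Finset.sum_congr rfl fun x _ => ?_
    simp only [shiftedSq]; ring
  have i3 : fieldZ J (reflectField ρ Lᶜ h) = ∫ p : Conf V × Conf V, Real.exp (g p.1) *
      Real.exp (g p.2) * Real.exp (∑ i, w i * (d i p.1 * d i p.2)) := by
    rw [fieldZ, ← hρ.integral_fold (by fun_prop)]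
    refine integral_congr_ae (ae_of_all _ fun p => ?_)
    simp only [← Real.exp_add]
    rw [hρ.fieldEnergy_fold_reflectField_compl, hsplit]
    simp only [hg, hd, Sum.elim_inl, Sum.elim_inr]
    congr 1
    refine hadd _ _ _ _ _ _ ?_
    rw [← Finset.sum_add_distrib, ← Finset.sum_add_distrib]
    refine Finset.sum_congr rfl fun x _ => ?_
    simp only [shiftedSq]; ring
  rw [i1, i2, i3]
  exact key

end Reflection

section GaussianDomination

variable {V : Type*} [Fintype V]

theorem continuous_fieldZ (J : V → V → ℝ) : Continuous (fieldZ J) := by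
  have := continuous_fieldEnergy_uncurry J
  have h := continuous_parametric_integral_of_continuous (μ := (volume : Measure (Conf V)))
    (f := fun h θ => Real.exp (fieldEnergy J h θ)) (by fun_prop) (isCompact_univ)
  simp only [Measure.restrict_univ] at h
  exact h

theorem fieldZ_pos (J : V → V → ℝ) (h : V × V → ℝ) : 0 < fieldZ J h :=
  integral_exp_pos (integrable_of_continuous' (by fun_prop))

theorem fieldZ_le_one {J : V → V → ℝ} (hJ : ∀ x y, 0 ≤ J x y) (h : V × V → ℝ) :
    fieldZ J h ≤ 1 := by
  have h1 : ∀ θ, Real.exp (fieldEnergy J h θ) ≤ 1 := fun θ => by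
    rw [Real.exp_le_one_iff, fieldEnergy]
    have : 0 ≤ ∑ x, ∑ y, J x y * shiftedSq (θ x) (θ y) (h (x, y)) :=
      Finset.sum_nonneg fun x _ => Finset.sum_nonneg fun y _ => mul_nonneg (hJ x y) (by
        unfold shiftedSq; positivity)
    linarith
  calc fieldZ J h ≤ ∫ _ : Conf V, (1 : ℝ) :=
        integral_mono (integrable_of_continuous' (by fun_prop)) (integrable_const _) h1
    _ = 1 := by simp

theorem fieldZ_congr {J : V → V → ℝ} {h h' : V × V → ℝ}
    (H : ∀ x y, J x y ≠ 0 → h (x, y) = h' (x, y)) : fieldZ J h = fieldZ J h' := by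
  have : fieldEnergy J h = fieldEnergy J h' := by
    ext θ
    unfold fieldEnergy
    congr 1
    refine Finset.sum_congr rfl fun x _ => Finset.sum_congr rfl fun y _ => ?_
    by_cases hJ : J x y = 0
    · simp [hJ]
    · rw [H x y hJ]
  rw [fieldZ, this, fieldZ]

/-- The square of the Euclidean norm of a field. -/
def normSq (h : V × V → ℝ) : ℝ := ∑ e, h e ^ 2

@[fun_prop]
theorem continuous_normSq : Continuous (normSq (V := V)) := by
  unfold normSq
  fun_prop

theorem sq_norm_le_normSq (h : V × V → ℝ) : ‖h‖ ^ 2 ≤ normSq h := by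
  have h0 : 0 ≤ normSq h := Finset.sum_nonneg fun e _ => sq_nonneg _
  have : ‖h‖ ≤ √(normSq h) := (pi_norm_le_iff_of_nonneg (Real.sqrt_nonneg _)).2 fun e =>
    Real.abs_le_sqrt (Finset.single_le_sum (f := fun e => h e ^ 2) (fun e _ => sq_nonneg _)
      (Finset.mem_univ e))
  calc ‖h‖ ^ 2 ≤ √(normSq h) ^ 2 := by gcongr
    _ = normSq h := Real.sq_sqrt h0

theorem normSq_reflectField [DecidableEq V] {ρ : V → V} {L : Finset V} (h1 : ∀ x, ρ (ρ x) = x)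
    (h2 : ∀ x, ρ x ∈ L ↔ x ∉ L) (h : V × V → ℝ) :
    normSq (reflectField ρ L h) = ∑ e, if e.1 ∈ L ∧ e.2 ∈ L then 2 * h e ^ 2 else 0 := by
  have e1 : ∑ e : V × V, (if e.1 ∉ L ∧ e.2 ∉ L then h (ρ e.1, ρ e.2) ^ 2 else 0) =
      ∑ e, if e.1 ∈ L ∧ e.2 ∈ L then h e ^ 2 else 0 := by
    refine Finset.sum_nbij' (fun e => (ρ e.1, ρ e.2)) (fun e => (ρ e.1, ρ e.2)) ?_ ?_ ?_ ?_ ?_ <;>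
      simp [h1, h2]
  calc normSq (reflectField ρ L h) = ∑ e, ((if e.1 ∈ L ∧ e.2 ∈ L then h e ^ 2 else 0) +
        if e.1 ∉ L ∧ e.2 ∉ L then h (ρ e.1, ρ e.2) ^ 2 else 0) := by
        refine Finset.sum_congr rfl fun e _ => ?_
        unfold reflectField
        split_ifs <;> first | simp; done | tauto
    _ = _ := by
        rw [Finset.sum_add_distrib, e1, ← Finset.sum_add_distrib]
        refine Finset.sum_congr rfl fun e _ => ?_
        split_ifs <;> ring

theorem IsReflection.normSq_add_le [DecidableEq V] {J : V → V → ℝ} {ρ : V → V} {L : Finset V}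
    (hρ : IsReflection J ρ L) (h : V × V → ℝ) {x y : V} (hxy : x ∈ L ↔ y ∉ L) :
    normSq (reflectField ρ L h) + normSq (reflectField ρ Lᶜ h) + 2 * h (x, y) ^ 2
      ≤ 2 * normSq h := by
  rw [normSq_reflectField hρ.invol hρ.mem_iff,
    normSq_reflectField hρ.invol (by simp [hρ.mem_iff]), normSq, Finset.mul_sum]
  have h1 : 2 * h (x, y) ^ 2 = ∑ e : V × V, if e = (x, y) then 2 * h e ^ 2 else 0 := by simp
  rw [h1, ← Finset.sum_add_distrib, ← Finset.sum_add_distrib]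
  refine Finset.sum_le_sum fun e _ => ?_
  have := sq_nonneg (h e)
  by_cases he : e = (x, y)
  · subst he
    by_cases hx : x ∈ L <;> by_cases hy : y ∈ L <;> simp_all
  · by_cases hx : e.1 ∈ L <;> by_cases hy : e.2 ∈ L <;> simp_all

variable {J : V → V → ℝ}

/-- Any two coupled vertices are separated by a reflection. -/
def IsReflectionPositive (J : V → V → ℝ) : Prop :=
  (∀ x y, 0 ≤ J x y) ∧
    ∀ x y, J x y ≠ 0 → ∃ ρ : V → V, ∃ L : Finset V, IsReflection J ρ L ∧ (x ∈ L ↔ y ∉ L)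

theorem IsReflectionPositive.exists_max (hJ : IsReflectionPositive J) {lam : ℝ} (hl : 0 < lam) :
    ∃ m, ∀ h, fieldZ J h * Real.exp (-lam * normSq h) ≤
      fieldZ J m * Real.exp (-lam * normSq m) := by
  have hc := continuous_fieldZ J
  refine Continuous.exists_forall_ge' (f := fun h => fieldZ J h * Real.exp (-lam * normSq h))
    (by fun_prop) 0 ?_
  have hZ := fieldZ_pos J 0
  have ht : Tendsto (fun h : V × V → ℝ => Real.exp (-(lam * ‖h‖ ^ 2))) (cocompact _) (nhds 0) :=
    Real.tendsto_exp_neg_atTop_nhds_zero.comp (Tendsto.const_mul_atTop hl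
      ((tendsto_pow_atTop two_ne_zero).comp (tendsto_norm_cocompact_atTop (E := V × V → ℝ))))
  filter_upwards [ht.eventually_le_const hZ] with h hh
  have h0 : normSq (0 : V × V → ℝ) = 0 := by simp [normSq]
  calc fieldZ J h * Real.exp (-lam * normSq h) ≤ 1 * Real.exp (-(lam * ‖h‖ ^ 2)) := by
        gcongr
        · exact fieldZ_le_one hJ.1 h
        · nlinarith [sq_norm_le_normSq h]
    _ ≤ fieldZ J 0 * Real.exp (-lam * normSq (0 : V × V → ℝ)) := by
        rw [h0]; simpa using hh

/-- Gaussian domination. -/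
theorem IsReflectionPositive.fieldZ_le [DecidableEq V] (hJ : IsReflectionPositive J)
    (h : V × V → ℝ) :
    fieldZ J h ≤ fieldZ J 0 := by
  have key : ∀ lam > 0, fieldZ J h * Real.exp (-lam * normSq h) ≤ fieldZ J 0 := by
    intro lam hl
    obtain ⟨m, hm⟩ := hJ.exists_max hl
    have hz : ∀ x y, J x y ≠ 0 → m (x, y) = (0 : V × V → ℝ) (x, y) := by
      intro x y hxy
      obtain ⟨ρ, L, hρ, hL⟩ := hJ.2 x y hxy
      have h1 := hρ.fieldZ_sq_le hJ.1 m
      have h2 := hm (reflectField ρ L m)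
      have h3 := hm (reflectField ρ Lᶜ m)
      have h4 := hρ.normSq_add_le m hL
      set a := reflectField ρ L m
      set b := reflectField ρ Lᶜ m
      have hpos := fieldZ_pos J m
      have h5 : (fieldZ J m * Real.exp (-lam * normSq m)) ^ 2 ≤
          (fieldZ J m * Real.exp (-lam * normSq m)) ^ 2 * Real.exp (-(2 * lam * m (x, y) ^ 2)) :=
        calc (fieldZ J m * Real.exp (-lam * normSq m)) ^ 2
            = fieldZ J m ^ 2 * Real.exp (-lam * (2 * normSq m)) := by
              rw [mul_pow, ← Real.exp_nat_mul]; ring_nf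
          _ ≤ (fieldZ J a * fieldZ J b) *
              Real.exp (-lam * (normSq a + normSq b + 2 * m (x, y) ^ 2)) := by
              have := fieldZ_pos J a
              have := fieldZ_pos J b
              gcongr ?_ * Real.exp ?_
              nlinarith
          _ = (fieldZ J a * Real.exp (-lam * normSq a)) * (fieldZ J b * Real.exp (-lam * normSq b))
              * Real.exp (-(2 * lam * m (x, y) ^ 2)) := by
              rw [show -lam * (normSq a + normSq b + 2 * m (x, y) ^ 2) = -lam * normSq a +
                -lam * normSq b + -(2 * lam * m (x, y) ^ 2) by ring, Real.exp_add, Real.exp_add]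
              ring
          _ ≤ _ := by
              have := fieldZ_pos J b
              rw [sq (fieldZ J m * _)]
              gcongr
      have h6 : 1 ≤ Real.exp (-(2 * lam * m (x, y) ^ 2)) :=
        le_of_mul_le_mul_left (by simpa using h5) (by positivity)
      rw [Real.one_le_exp_iff] at h6
      have h7 : m (x, y) ^ 2 = 0 := le_antisymm (by nlinarith) (sq_nonneg _)
      simpa using h7
    have hle : Real.exp (-lam * normSq m) ≤ 1 := by
      have : 0 ≤ normSq m := Finset.sum_nonneg fun e _ => sq_nonneg _
      rw [Real.exp_le_one_iff]; nlinarith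
    calc _ ≤ _ := hm h
      _ ≤ fieldZ J m * 1 := by
        have := fieldZ_pos J m
        gcongr
      _ = fieldZ J 0 := by rw [mul_one, fieldZ_congr hz]
  have ht : Tendsto (fun lam : ℝ => fieldZ J h * Real.exp (-lam * normSq h))
      (nhdsWithin 0 (Set.Ioi 0))
      (nhds (fieldZ J h * Real.exp (-0 * normSq h))) :=
    (Continuous.tendsto (by fun_prop) 0).mono_left nhdsWithin_le_nhds
  have := le_of_tendsto ht (eventually_mem_nhdsWithin.mono fun lam hl => key lam hl)
  simpa using this

theorem fieldEnergy_eq (J : V → V → ℝ) (h : V × V → ℝ) (θ : Conf V) :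
    fieldEnergy J h θ = energy J θ - ∑ x, ∑ y, J x y
      - ∑ x, ∑ y, J x y * h (x, y) * ((θ x).cos - (θ y).cos)
      - 1 / 2 * ∑ x, ∑ y, J x y * h (x, y) ^ 2 := by
  unfold fieldEnergy energy
  simp only [Finset.mul_sum, ← Finset.sum_sub_distrib]
  refine Finset.sum_congr rfl fun x _ => Finset.sum_congr rfl fun y _ => ?_
  rw [shiftedSq, angle_cos_sub]
  linear_combination (-(J x y) / 2) * (Real.Angle.cos_sq_add_sin_sq (θ x)) +
    (-(J x y) / 2) * (Real.Angle.cos_sq_add_sin_sq (θ y))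

theorem one_add_sq_le_cosh (x : ℝ) : 1 + x ^ 2 / 2 ≤ Real.cosh x := by
  have h := sum_le_hasSum (Finset.range 2) (fun i _ => by rw [pow_mul]; positivity)
    (Real.hasSum_cosh x)
  simpa [Finset.sum_range_succ] using h

/-- The infrared bound, as a bound on second moments of linear combinations of gradients. -/
theorem IsReflectionPositive.integral_sq_le [DecidableEq V] (hJ : IsReflectionPositive J)
    (h : V × V → ℝ) :
    ∫ θ, (∑ x, ∑ y, J x y * h (x, y) * ((θ x).cos - (θ y).cos)) ^ 2 * Real.exp (energy J θ) ≤
      (∑ x, ∑ y, J x y * h (x, y) ^ 2) * ∫ θ, Real.exp (energy J θ) := by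
  set X : Conf V → ℝ := fun θ => ∑ x, ∑ y, J x y * h (x, y) * ((θ x).cos - (θ y).cos) with hX
  set Q : ℝ := ∑ x, ∑ y, J x y * h (x, y) ^ 2 with hQ
  set c : ℝ := ∑ x, ∑ y, J x y with hc
  have hXc : Continuous X := by fun_prop
  have hI : ∀ {f : Conf V → ℝ}, Continuous f → Integrable f := fun hf =>
    integrable_of_continuous' hf
  have hZ : ∀ t : ℝ, ∫ θ, Real.exp (energy J θ) * Real.exp (-(t * X θ)) =
      Real.exp (c + t ^ 2 / 2 * Q) * fieldZ J (t • h) := by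
    intro t
    rw [fieldZ, ← integral_const_mul]
    refine integral_congr_ae (ae_of_all _ fun θ => ?_)
    simp only [← Real.exp_add]
    rw [fieldEnergy_eq]
    have h1 : ∑ x, ∑ y, J x y * (t • h) (x, y) * ((θ x).cos - (θ y).cos) = t * X θ := by
      simp only [hX, Finset.mul_sum, Pi.smul_apply, smul_eq_mul]
      exact Finset.sum_congr rfl fun x _ => Finset.sum_congr rfl fun y _ => by ring
    have h2 : ∑ x, ∑ y, J x y * (t • h) (x, y) ^ 2 = t ^ 2 * Q := by
      simp only [hQ, Finset.mul_sum, Pi.smul_apply, smul_eq_mul]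
      exact Finset.sum_congr rfl fun x _ => Finset.sum_congr rfl fun y _ => by ring
    rw [h1, h2]
    congr 1
    ring
  have hle : ∀ t : ℝ, ∫ θ, Real.exp (energy J θ) * Real.exp (-(t * X θ)) ≤
      Real.exp (t ^ 2 / 2 * Q) * ∫ θ, Real.exp (energy J θ) := by
    intro t
    have h0 := hZ 0
    simp only [zero_mul, neg_zero, Real.exp_zero, mul_one, zero_smul] at h0
    rw [hZ t, h0]
    have := hJ.fieldZ_le (t • h)
    calc Real.exp (c + t ^ 2 / 2 * Q) * fieldZ J (t • h) ≤
        Real.exp (c + t ^ 2 / 2 * Q) * fieldZ J 0 := by gcongr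
      _ = _ := by
        rw [Real.exp_add]
        norm_num
        ring
  have hpos : 0 < ∫ θ, Real.exp (energy J θ) := integral_exp_pos (hI (by fun_prop))
  have key : ∀ t > 0, ∫ θ, X θ ^ 2 * Real.exp (energy J θ) ≤
      Q * Real.exp (t ^ 2 / 2 * Q) * ∫ θ, Real.exp (energy J θ) := by
    intro t ht
    have h1 : ∫ θ, (1 + (t * X θ) ^ 2 / 2) * Real.exp (energy J θ) ≤
        ∫ θ, Real.cosh (t * X θ) * Real.exp (energy J θ) := by
      refine integral_mono (hI (by fun_prop)) (hI ?_) fun θ => ?_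
      · have := Real.continuous_cosh
        fun_prop
      · exact mul_le_mul_of_nonneg_right (one_add_sq_le_cosh _) (Real.exp_pos _).le
    have h2 : ∫ θ, Real.cosh (t * X θ) * Real.exp (energy J θ) =
        ((∫ θ, Real.exp (energy J θ) * Real.exp (-(t * X θ))) +
          ∫ θ, Real.exp (energy J θ) * Real.exp (-(-t * X θ))) / 2 := by
      rw [← integral_add (hI (by fun_prop)) (hI (by fun_prop)), ← integral_div]
      refine integral_congr_ae (ae_of_all _ fun θ => ?_)
      simp only [Real.cosh_eq]
      ring_nf
    have h3 : ∫ θ, (1 + (t * X θ) ^ 2 / 2) * Real.exp (energy J θ) =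
        (∫ θ, Real.exp (energy J θ)) + t ^ 2 / 2 * ∫ θ, X θ ^ 2 * Real.exp (energy J θ) := by
      rw [← integral_const_mul, ← integral_add (hI (by fun_prop)) (hI (by fun_prop))]
      refine integral_congr_ae (ae_of_all _ fun θ => ?_)
      ring
    have h4 := hle t
    have h5 := hle (-t)
    rw [neg_sq] at h5
    have h6 : 1 - t ^ 2 / 2 * Q ≤ Real.exp (-(t ^ 2 / 2 * Q)) := Real.one_sub_le_exp_neg _
    have h7 : Real.exp (-(t ^ 2 / 2 * Q)) * Real.exp (t ^ 2 / 2 * Q) = 1 := by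
      rw [← Real.exp_add]; simp
    have h8 := Real.exp_pos (t ^ 2 / 2 * Q)
    set E := Real.exp (t ^ 2 / 2 * Q)
    set Z := ∫ θ, Real.exp (energy J θ)
    set A := ∫ θ, X θ ^ 2 * Real.exp (energy J θ)
    have h9 : E - 1 ≤ t ^ 2 / 2 * Q * E := by nlinarith
    have h10 : t ^ 2 / 2 * A ≤ (E - 1) * Z := by linarith
    have h11 : t ^ 2 / 2 * A ≤ t ^ 2 / 2 * (Q * E * Z) := by nlinarith
    exact le_of_mul_le_mul_left h11 (by positivity)
  have ht : Tendsto (fun t : ℝ => Q * Real.exp (t ^ 2 / 2 * Q) * ∫ θ, Real.exp (energy J θ))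
      (nhdsWithin 0 (Set.Ioi 0))
      (nhds (Q * Real.exp (0 ^ 2 / 2 * Q) * ∫ θ, Real.exp (energy J θ))) :=
    (Continuous.tendsto (by fun_prop) 0).mono_left nhdsWithin_le_nhds
  have := ge_of_tendsto ht (eventually_mem_nhdsWithin.mono fun t ht => key t ht)
  simpa using this

end GaussianDomination

section Torus

/-- The discrete torus of side `2 * N`. -/
abbrev Torus (N : ℕ) : Type := Fin 3 → ZMod (2 * N)

/-- Nearest neighbours on the torus. -/
def TorusAdj {N : ℕ} (x y : Torus N) : Prop :=
  ∃ i, y = x + Pi.single i 1 ∨ x = y + Pi.single i 1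

open Classical in
/-- The nearest-neighbour coupling on the torus. -/
def torusJ (N : ℕ) (β : ℝ) (x y : Torus N) : ℝ := if TorusAdj x y then β / 6 else 0

variable {N : ℕ} {β : ℝ}

theorem torusAdj_comm {x y : Torus N} : TorusAdj x y ↔ TorusAdj y x :=
  exists_congr fun _ => or_comm

theorem torusJ_nonneg (hβ : 0 ≤ β) (x y : Torus N) : 0 ≤ torusJ N β x y := by
  unfold torusJ
  split_ifs <;> positivity

/-- The reflection of the torus exchanging the coordinates `c` and `c + 1` along the axis `i`. -/
def mirror (i : Fin 3) (c : ZMod (2 * N)) (z : Torus N) : Torus N :=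
  Function.update z i (2 * c + 1 - z i)

theorem mirror_mirror (i : Fin 3) (c : ZMod (2 * N)) (z : Torus N) :
    mirror i c (mirror i c z) = z := by
  simp [mirror]

theorem TorusAdj.mirror (i : Fin 3) (c : ZMod (2 * N)) {x y : Torus N} (h : TorusAdj x y) :
    TorusAdj (mirror i c x) (mirror i c y) := by
  have aux : ∀ {x y : Torus N} {j}, y = x + Pi.single j 1 →
      TorusAdj (XYModel.mirror i c x) (XYModel.mirror i c y) := by
    rintro x y j rfl
    refine ⟨j, ?_⟩
    by_cases hj : j = i
    · subst hj
      right
      ext k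
      by_cases hk : k = j
      · subst hk; simp [XYModel.mirror]; ring
      · simp [XYModel.mirror, hk]
    · left
      ext k
      by_cases hk : k = i
      · subst hk; simp [XYModel.mirror, Ne.symm hj]
      · simp [XYModel.mirror, hk]
  obtain ⟨j, h | h⟩ := h
  · exact aux h
  · exact torusAdj_comm.1 (aux h)

theorem val_neg_add_one [NeZero N] (w : ZMod (2 * N)) : (-(w + 1)).val = 2 * N - 1 - w.val := by
  have hw := w.val_lt
  have h : -(w + 1) = ((2 * N - 1 - w.val : ℕ) : ZMod (2 * N)) := by
    rw [Nat.sub_sub, Nat.cast_sub (by omega), ZMod.natCast_self, Nat.cast_add,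
      ZMod.natCast_zmod_val]
    push_cast
    ring
  rw [h, ZMod.val_natCast_of_lt (by omega)]

theorem two_mul_add_one_eq_zero [NeZero N] {w : ZMod (2 * N)}
    (h : w.val < N ↔ ¬ (w + 1).val < N) : 2 * (w + 1) = 0 := by
  have hw := w.val_lt
  have hN := NeZero.pos N
  have hcast : w + 1 = ((w.val + 1 : ℕ) : ZMod (2 * N)) := by
    rw [Nat.cast_add, ZMod.natCast_zmod_val, Nat.cast_one]
  rcases Nat.lt_or_ge (w.val + 1) (2 * N) with h1 | h1
  · have h2 : (w + 1).val = w.val + 1 := by rw [hcast, ZMod.val_natCast_of_lt h1]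
    have h3 : w.val + 1 = N := by omega
    have h4 : ((2 * N : ℕ) : ZMod (2 * N)) = 0 := ZMod.natCast_self _
    rw [hcast, h3]
    exact_mod_cast h4
  · have h3 : w.val + 1 = 2 * N := by omega
    rw [hcast, h3, ZMod.natCast_self, mul_zero]

theorem isReflection_mirror [NeZero N] (β : ℝ) (i : Fin 3) (c : ZMod (2 * N)) :
    IsReflection (torusJ N β) (mirror i c) {z | (z i - c - 1).val < N} where
  invol := mirror_mirror i c
  mem_iff x := by
    have h := val_neg_add_one (x i - c - 1)
    have hlt := (x i - c - 1).val_lt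
    have : mirror i c x i - c - 1 = -(x i - c - 1 + 1) := by simp [mirror]; ring
    simp only [Finset.mem_filter, Finset.mem_univ, true_and, this, h]
    omega
  coupling x y := by
    have : TorusAdj (mirror i c x) (mirror i c y) ↔ TorusAdj x y :=
      ⟨fun h => by simpa [mirror_mirror] using h.mirror i c, fun h => h.mirror i c⟩
    by_cases h : TorusAdj x y <;> simp [torusJ, this, h]
  cross x y h hJ := by
    have hadj : TorusAdj x y := by
      by_contra hn
      exact hJ (by simp [torusJ, hn])
    simp only [Finset.mem_filter, Finset.mem_univ, true_and] at h
    have aux : ∀ {x y : Torus N} {j}, ((x i - c - 1).val < N ↔ ¬ (y i - c - 1).val < N) →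
        y = x + Pi.single j 1 → y = mirror i c x := by
      rintro x y j h rfl
      have hj : j = i := by
        by_contra hj
        simp [Ne.symm hj] at h
        omega
      subst hj
      ext k
      by_cases hk : k = j
      · subst hk
        have : (x + Pi.single k 1 : Torus N) k - c - 1 = x k - c - 1 + 1 := by simp; ring
        rw [this] at h
        have := two_mul_add_one_eq_zero h
        simp only [mirror, Pi.add_apply, Pi.single_eq_same, Function.update_self]
        linear_combination this
      · simp [mirror, hk]
    obtain ⟨j, hj | hj⟩ := hadj
    · exact aux h hj
    · rw [aux (by tauto) hj, mirror_mirror]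

theorem isReflectionPositive_torusJ [NeZero N] (hβ : 0 ≤ β) :
    IsReflectionPositive (torusJ N β) := by
  refine ⟨torusJ_nonneg hβ, fun x y hJ => ?_⟩
  have hadj : TorusAdj x y := by
    by_contra hn
    exact hJ (by simp [torusJ, hn])
  have hN := NeZero.pos N
  have h0 : (-1 : ZMod (2 * N)).val = 2 * N - 1 := by
    have := val_neg_add_one (0 : ZMod (2 * N))
    simpa using this
  obtain ⟨i, hi | hi⟩ := hadj
  · refine ⟨_, _, isReflection_mirror β i (x i), ?_⟩
    have h1 : x i - x i - 1 = -1 := by ring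
    have h2 : y i - x i - 1 = 0 := by simp [hi]
    simp only [Finset.mem_filter, Finset.mem_univ, true_and, h1, h2, h0, ZMod.val_zero]
    omega
  · refine ⟨_, _, isReflection_mirror β i (y i), ?_⟩
    have h1 : y i - y i - 1 = -1 := by ring
    have h2 : x i - y i - 1 = 0 := by simp [hi]
    simp only [Finset.mem_filter, Finset.mem_univ, true_and, h1, h2, h0, ZMod.val_zero]
    omega

/-- The infrared bound on the torus. -/
theorem torus_integral_sq_le [NeZero N] (hβ : 0 < β) (B : Finset (Torus N)) (i : Fin 3) :
    ∫ θ : Conf (Torus N), (∑ x ∈ B, ((θ x).cos - (θ (x + Pi.single i 1)).cos)) ^ 2 *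
        Real.exp (energy (torusJ N β) θ) ≤
      6 / β * B.card * ∫ θ : Conf (Torus N), Real.exp (energy (torusJ N β) θ) := by
  have h := (isReflectionPositive_torusJ (N := N) hβ.le).integral_sq_le
    fun e => if e.1 ∈ B ∧ e.2 = e.1 + Pi.single i 1 then 6 / β else 0
  have hJ : ∀ x : Torus N, torusJ N β x (x + Pi.single i 1) = β / 6 := fun x =>
    if_pos ⟨i, Or.inl rfl⟩
  have hin : ∀ (g : ℝ → ℝ) (hg : g 0 = 0) (u : Torus N → Torus N → ℝ),
      ∑ x, ∑ y, torusJ N β x y * g (if x ∈ B ∧ y = x + Pi.single i 1 then 6 / β else 0) * u x y =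
      ∑ x ∈ B, β / 6 * g (6 / β) * u x (x + Pi.single i 1) := by
    intro g hg u
    rw [← Finset.sum_filter_add_sum_filter_not Finset.univ (· ∈ B),
      Finset.sum_eq_zero (s := Finset.univ.filter (· ∉ B)), add_zero, Finset.filter_mem_eq_inter,
      Finset.univ_inter]
    · refine Finset.sum_congr rfl fun x hx => ?_
      rw [Finset.sum_eq_single_of_mem (x + Pi.single i 1) (Finset.mem_univ _)]
      · simp [hx, hJ]
      · intro y _ hy; simp [hy, hg]
    · intro x hx
      simp only [Finset.mem_filter, Finset.mem_univ, true_and] at hx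
      exact Finset.sum_eq_zero fun y _ => by simp [hx, hg]
  have h1 : ∀ θ : Conf (Torus N), _ := fun θ => hin id rfl fun x y => (θ x).cos - (θ y).cos
  have h2 := hin (· ^ 2) (by simp) fun _ _ => 1
  simp only [id, mul_one] at h1 h2
  simp only [h1, h2] at h
  have e1 : β / 6 * (6 / β) = 1 := by field_simp
  have e2 : β / 6 * (6 / β) ^ 2 = 6 / β := by field_simp
  simp only [e1, e2, one_mul, Finset.sum_const, nsmul_eq_mul] at h
  rwa [mul_comm (6 / β)]

end Torus

section Multiscale

/-- The discrete box of side `s`. -/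
def box (s : ℕ) : Finset (Fin 3 → ℕ) := Fintype.piFinset fun _ => Finset.range s

theorem mem_box {s : ℕ} {z : Fin 3 → ℕ} : z ∈ box s ↔ ∀ i, z i < s := by
  simp [box, Fintype.mem_piFinset]

theorem card_box (s : ℕ) : (box s).card = s ^ 3 := by
  simp [box, Fintype.card_piFinset]

/-- A box of side `r * s` is tiled by boxes of side `s`. -/
theorem sum_box_mul {E : Type*} [AddCommMonoid E] (f : (Fin 3 → ℕ) → E) (r : ℕ) {s : ℕ}
    (hs : 0 < s) : ∑ z ∈ box (r * s), f z = ∑ u ∈ box r, ∑ z ∈ box s, f (z + s • u) := by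
  rw [← Finset.sum_product']
  refine Finset.sum_nbij' (fun z => (fun i => z i / s, fun i => z i % s))
    (fun p => p.2 + s • p.1) ?_ ?_ ?_ ?_ ?_
  · intro z hz
    rw [mem_box] at hz
    simp only [Finset.mem_product, mem_box]
    exact ⟨fun i => (Nat.div_lt_iff_lt_mul hs).2 (hz i), fun i => Nat.mod_lt _ hs⟩
  · intro p hp
    simp only [Finset.mem_product, mem_box] at hp
    rw [mem_box]
    intro i
    have h1 := hp.1 i
    have h2 := hp.2 i
    simp only [Pi.add_apply, Pi.smul_apply, smul_eq_mul]
    calc p.2 i + s * p.1 i < s * 1 + s * p.1 i := by omega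
      _ = s * (p.1 i + 1) := by ring
      _ ≤ s * r := Nat.mul_le_mul_left _ h1
      _ = r * s := mul_comm _ _
  · intro z _
    ext i
    simp [Nat.mod_add_div]
  · intro p hp
    simp only [Finset.mem_product, mem_box] at hp
    ext i
    · simp [Nat.add_mul_div_left _ _ hs, Nat.div_eq_of_lt (hp.2 i)]
    · simp [Nat.mod_eq_of_lt (hp.2 i)]
  · intro z _
    congr 1
    ext i
    simp [Nat.mod_add_div]

variable {E : Type*} [SeminormedAddCommGroup E] {f : (Fin 3 → ℕ) → E} {K : ℝ} {M : ℕ}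

/-- The square-root bound on sums of increments over subsets of the box of side `M`. -/
def IncrementBound (f : (Fin 3 → ℕ) → E) (K : ℝ) (M : ℕ) : Prop :=
  ∀ B ⊆ box M, ∀ i, ‖∑ z ∈ B, (f z - f (z + Pi.single i 1))‖ ≤ √(K * B.card)

theorem IncrementBound.norm_translate_le (hf : IncrementBound f K M) {s : ℕ} (hM : 2 * s ≤ M)
    (n : ℕ) (v : Fin 3 → ℕ) (hn : ∑ i, v i = n) (hv : ∀ i, v i ≤ s) :
    ‖∑ z ∈ box s, f z - ∑ z ∈ box s, f (z + v)‖ ≤ n * √(K * s ^ 3) := by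
  induction n generalizing v with
  | zero =>
    have : v = 0 := by
      ext i
      exact (Finset.sum_eq_zero_iff.1 hn) i (Finset.mem_univ i)
    simp [this]
  | succ n ih =>
    obtain ⟨i, hi⟩ : ∃ i, v i ≠ 0 := by
      by_contra! h
      simp [h] at hn
    set v' : Fin 3 → ℕ := v - Pi.single i 1 with hv'
    have hvv : v = v' + Pi.single i 1 := by
      ext j
      by_cases hj : j = i
      · subst hj; simp [hv']; omega
      · simp [hv', hj]
    have hn' : ∑ j, v' j = n := by
      rw [hvv] at hn
      simp only [Pi.add_apply, Finset.sum_add_distrib, Finset.sum_pi_single', Finset.mem_univ,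
        if_true] at hn
      omega
    have hle : ∀ j, v' j ≤ v j := fun j => by rw [hvv]; simp
    have hlt : v' i < v i := by rw [hvv]; simp
    have h1 := ih v' hn' fun j => (hle j).trans (hv j)
    have hinj : Set.InjOn (fun z => z + v') (box s) := fun a _ b _ h => add_right_cancel h
    have h2 := hf ((box s).image fun z => z + v') (by
      intro z hz
      obtain ⟨w, hw, rfl⟩ := Finset.mem_image.1 hz
      rw [mem_box] at hw ⊢
      intro j
      have := hw j
      have := hle j
      have := hv j
      simp only [Pi.add_apply]
      omega) i
    rw [Finset.sum_image hinj, Finset.card_image_of_injOn hinj, card_box,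
      Finset.sum_sub_distrib] at h2
    have h3 : ∑ z ∈ box s, f (z + v) = ∑ z ∈ box s, f (z + v' + Pi.single i 1) := by
      simp only [add_assoc, ← hvv]
    rw [h3]
    push_cast at h2 ⊢
    calc _ ≤ _ := norm_sub_le_norm_sub_add_norm_sub _ (∑ z ∈ box s, f (z + v')) _
      _ ≤ n * √(K * s ^ 3) + √(K * s ^ 3) := add_le_add h1 h2
      _ = _ := by ring

variable [NormedSpace ℝ E]

/-- The average of `f` over the box of side `s`. -/
def boxAvg (f : (Fin 3 → ℕ) → E) (s : ℕ) : E := ((s : ℝ) ^ 3)⁻¹ • ∑ z ∈ box s, f z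

theorem IncrementBound.norm_boxAvg_le_double (hf : IncrementBound f K M) {s : ℕ}
    (hs : 0 < s) (hM : 2 * s ≤ M) : ‖boxAvg f s‖ ≤ 3 * √(K / s) + ‖boxAvg f (2 * s)‖ := by
  have hs' : (0 : ℝ) < s := by exact_mod_cast hs
  have hsq : √(K * s ^ 3) = s ^ 2 * √(K / s) := by
    rw [show K * (s : ℝ) ^ 3 = (s ^ 2) ^ 2 * (K / s) by field_simp,
      Real.sqrt_mul (by positivity), Real.sqrt_sq (by positivity)]
  have h1 : ∀ u ∈ box 2, ‖∑ z ∈ box s, f z - ∑ z ∈ box s, f (z + s • u)‖ ≤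
      3 * s * (s ^ 2 * √(K / s)) := by
    intro u hu
    rw [mem_box] at hu
    have hle : ∀ i, (s • u) i ≤ s := fun i => by
      have := hu i
      simp only [Pi.smul_apply, smul_eq_mul]
      calc s * u i ≤ s * 1 := Nat.mul_le_mul_left _ (by omega)
        _ = s := mul_one s
    refine (hf.norm_translate_le hM _ _ rfl hle).trans ?_
    rw [hsq]
    gcongr
    have : ∑ i, (s • u) i ≤ ∑ _i : Fin 3, s := Finset.sum_le_sum fun i _ => hle i
    have h3 : ∑ i, (s • u) i ≤ 3 * s := by simpa using this
    exact_mod_cast h3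
  have h2 : ‖(8 : ℝ) • ∑ z ∈ box s, f z - ∑ z ∈ box (2 * s), f z‖ ≤
      8 * (3 * s * (s ^ 2 * √(K / s))) := by
    have h8 : (8 : ℝ) • ∑ z ∈ box s, f z = ∑ _u ∈ box 2, ∑ z ∈ box s, f z := by
      rw [Finset.sum_const, card_box, ← Nat.cast_smul_eq_nsmul ℝ]
      norm_num
    rw [sum_box_mul f 2 hs, h8, ← Finset.sum_sub_distrib]
    refine (norm_sum_le_of_le _ h1).trans (le_of_eq ?_)
    rw [Finset.sum_const, card_box]
    norm_num
  have h3 : boxAvg f s - boxAvg f (2 * s) =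
      (8 * (s : ℝ) ^ 3)⁻¹ • ((8 : ℝ) • ∑ z ∈ box s, f z - ∑ z ∈ box (2 * s), f z) := by
    rw [boxAvg, boxAvg, smul_sub, smul_smul]
    congr 2
    · field_simp
    · push_cast; ring_nf
  have h4 : ‖boxAvg f s - boxAvg f (2 * s)‖ ≤ 3 * √(K / s) := by
    rw [h3, norm_smul, Real.norm_of_nonneg (by positivity)]
    calc _ ≤ (8 * (s : ℝ) ^ 3)⁻¹ * (8 * (3 * s * (s ^ 2 * √(K / s)))) := by gcongr
      _ = _ := by field_simp
  linarith [norm_sub_norm_le (boxAvg f s) (boxAvg f (2 * s))]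

theorem IncrementBound.norm_boxAvg_le (hf : IncrementBound f K M) (hK : 0 ≤ K) {s : ℕ}
    (hs : 0 < s) (k : ℕ) (hM : 2 ^ k * s ≤ M) :
    ‖boxAvg f s‖ ≤ 12 * √(K / s) + ‖boxAvg f (2 ^ k * s)‖ := by
  have key : ‖boxAvg f s‖ ≤ 12 * √(K / s) - 12 * √(K / (2 ^ k * s : ℕ)) +
      ‖boxAvg f (2 ^ k * s)‖ := by
    induction k with
    | zero => simp
    | succ k ih =>
      have hM' : 2 * (2 ^ k * s) ≤ M := by rw [← mul_assoc, ← pow_succ']; exact hM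
      have h1 := ih (by omega)
      have h2 := hf.norm_boxAvg_le_double (s := 2 ^ k * s) (by positivity) hM'
      rw [pow_succ', mul_assoc]
      set t := 2 ^ k * s
      have h3 : √(K / (2 * t : ℕ)) = √(K / t) / √2 := by
        rw [← Real.sqrt_div (by positivity)]
        push_cast
        congr 1
        ring
      have h4 : √(K / t) / √2 ≤ 3 / 4 * √(K / t) := by
        rw [div_le_iff₀ (by positivity)]
        have : (4 / 3 : ℝ) ≤ √2 := Real.le_sqrt_of_sq_le (by norm_num)
        nlinarith [Real.sqrt_nonneg (K / t)]
      rw [h3]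
      linarith
  linarith [Real.sqrt_nonneg (K / (2 ^ k * s : ℕ))]

end Multiscale

section TwoPoint

variable {V W : Type*} [Fintype V] [Fintype W]

/-- The two-point function of the XY model with couplings `J`. -/
def twoPoint (J : V → V → ℝ) (a b : V) : ℝ :=
  (∫ θ, (θ a - θ b).cos * Real.exp (energy J θ)) / ∫ θ, Real.exp (energy J θ)

theorem integral_exp_energy_pos (J : V → V → ℝ) : 0 < ∫ θ, Real.exp (energy J θ) :=
  integral_exp_pos (integrable_of_continuous' (by fun_prop))

theorem angle_cos_le_one (u : Real.Angle) : u.cos ≤ 1 := by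
  induction u using Real.Angle.induction_on with
  | h x => exact Real.cos_le_one x

theorem twoPoint_le_one (J : V → V → ℝ) (a b : V) : twoPoint J a b ≤ 1 := by
  rw [twoPoint, div_le_one (integral_exp_energy_pos J)]
  refine integral_mono (integrable_of_continuous' (by fun_prop))
    (integrable_of_continuous' (by fun_prop)) fun θ => ?_
  exact mul_le_of_le_one_left (Real.exp_pos _).le (angle_cos_le_one _)

theorem twoPoint_mono {J J' : V → V → ℝ} (h0 : ∀ x y, 0 ≤ J x y) (h : ∀ x y, J x y ≤ J' x y)
    (a b : V) : twoPoint J a b ≤ twoPoint J' a b := by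
  rw [twoPoint, twoPoint, div_le_div_iff₀ (integral_exp_energy_pos J) (integral_exp_energy_pos J')]
  linarith [ginibre_mono h0 h a b]

theorem integral_comp_injective {ι : V → W} (hι : Function.Injective ι) {g : Conf V → ℝ}
    (hg : Continuous g) : ∫ θ : Conf W, g (fun v => θ (ι v)) = ∫ θ, g θ :=
  integral_comp_surjective
    (f := { toFun := fun (θ : Conf W) v => θ (ι v)
            map_zero' := rfl
            map_add' := fun _ _ => rfl })
    (continuous_pi fun _ => continuous_apply _) (fun θ => hι.surjective_comp_right θ) hg

theorem sum_ite_range [DecidableEq W] {ι : V → W} (hι : Function.Injective ι) (g : W → ℝ) :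
    ∑ w, (if w ∈ Finset.univ.image ι then g w else 0) = ∑ v, g (ι v) := by
  rw [Finset.sum_ite_mem, Finset.univ_inter, Finset.sum_image hι.injOn]

/-- Enlarging the graph increases the two-point function. -/
theorem twoPoint_le_of_injective {ι : V → W} (hι : Function.Injective ι) {J : V → V → ℝ}
    {J' : W → W → ℝ} (h0 : ∀ x y, 0 ≤ J x y) (h0' : ∀ x y, 0 ≤ J' x y)
    (h : ∀ x y, J x y ≤ J' (ι x) (ι y)) (a b : V) : twoPoint J a b ≤ twoPoint J' (ι a) (ι b) := by
  classical
  set R := Finset.univ.image ι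
  set J'' : W → W → ℝ := fun x y => if x ∈ R then if y ∈ R then J' x y else 0 else 0 with hJ''
  have hE : ∀ θ : Conf W, energy J'' θ = energy (fun x y => J' (ι x) (ι y)) fun v => θ (ι v) := by
    intro θ
    simp only [energy, hJ'', ite_mul, zero_mul, Finset.sum_ite_irrel, Finset.sum_const_zero]
    rw [sum_ite_range hι]
    exact Finset.sum_congr rfl fun x _ => sum_ite_range hι _
  have e : twoPoint (fun x y => J' (ι x) (ι y)) a b = twoPoint J'' (ι a) (ι b) := by
    simp only [twoPoint, hE]
    congr 1
    · exact (integral_comp_injective hι (g := fun θ => (θ a - θ b).cos *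
        Real.exp (energy (fun x y => J' (ι x) (ι y)) θ)) (by fun_prop)).symm
    · exact (integral_comp_injective hι
        (g := fun θ => Real.exp (energy (fun x y => J' (ι x) (ι y)) θ)) (by fun_prop)).symm
  calc twoPoint J a b ≤ twoPoint (fun x y => J' (ι x) (ι y)) a b := twoPoint_mono h0 h a b
    _ = twoPoint J'' (ι a) (ι b) := e
    _ ≤ _ := by
      refine twoPoint_mono (fun x y => ?_) (fun x y => ?_) _ _ <;> simp only [hJ''] <;>
        split_ifs <;> first | exact h0' _ _ | exact le_rfl

/-- By rotation invariance, each component carries half of the two-point function. -/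
theorem integral_cos_mul_cos (J : V → V → ℝ) (a b : V) :
    ∫ θ, (θ a).cos * (θ b).cos * Real.exp (energy J θ) =
      1 / 2 * ∫ θ, (θ a - θ b).cos * Real.exp (energy J θ) := by
  have h1 : ∫ θ, (θ a).cos * (θ b).cos * Real.exp (energy J θ) =
      ∫ θ, (θ a).sin * (θ b).sin * Real.exp (energy J θ) := by
    rw [← integral_add_right_eq_self (fun θ : Conf V => (θ a).cos * (θ b).cos *
      Real.exp (energy J θ)) fun _ => ((π / 2 : ℝ) : Real.Angle)]
    refine integral_congr_ae (ae_of_all _ fun θ => ?_)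
    have hE : energy J (θ + fun _ => ((π / 2 : ℝ) : Real.Angle)) = energy J θ := by
      simp [energy]
    simp only [hE, Pi.add_apply, Real.Angle.cos_add_pi_div_two]
    ring
  have h2 : ∫ θ, (θ a - θ b).cos * Real.exp (energy J θ) =
      (∫ θ, (θ a).cos * (θ b).cos * Real.exp (energy J θ)) +
      ∫ θ, (θ a).sin * (θ b).sin * Real.exp (energy J θ) := by
    rw [← integral_add (integrable_of_continuous' (by fun_prop))
      (integrable_of_continuous' (by fun_prop))]
    refine integral_congr_ae (ae_of_all _ fun θ => ?_)
    simp only [angle_cos_sub]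
    ring
  rw [h2, ← h1]
  ring

/-- The Gibbs measure with couplings `J`. -/
def gibbs (J : V → V → ℝ) : Measure (Conf V) := (volume : Measure (Conf V)).tilted (energy J)

instance (J : V → V → ℝ) : IsProbabilityMeasure (gibbs J) :=
  isProbabilityMeasure_tilted (integrable_of_continuous' (by fun_prop))

theorem integral_gibbs (J : V → V → ℝ) (g : Conf V → ℝ) :
    ∫ θ, g θ ∂(gibbs J) = (∫ θ, g θ * Real.exp (energy J θ)) / ∫ θ, Real.exp (energy J θ) := by
  rw [gibbs, integral_tilted, ← integral_div]
  refine integral_congr_ae (ae_of_all _ fun θ => ?_)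
  simp only [smul_eq_mul]
  ring

/-- The first component of the spin at `x`, as a square integrable random variable. -/
def spin (J : V → V → ℝ) (x : V) : Lp ℝ 2 (gibbs J) :=
  ContinuousMap.toLp 2 (gibbs J) ℝ ⟨fun θ => (θ x).cos, by fun_prop⟩

theorem norm_sq_toLp (J : V → V → ℝ) (g : C(Conf V, ℝ)) :
    ‖ContinuousMap.toLp 2 (gibbs J) ℝ g‖ ^ 2 =
      (∫ θ, g θ ^ 2 * Real.exp (energy J θ)) / ∫ θ, Real.exp (energy J θ) := by
  rw [← integral_gibbs, ← real_inner_self_eq_norm_sq, ContinuousMap.inner_toLp]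
  refine integral_congr_ae (ae_of_all _ fun θ => ?_)
  simp [sq]

theorem inner_spin (J : V → V → ℝ) (a b : V) :
    inner ℝ (spin J a) (spin J b) = 1 / 2 * twoPoint J a b := by
  rw [spin, spin, ContinuousMap.inner_toLp, twoPoint, ← mul_div_assoc, ← integral_cos_mul_cos,
    ← integral_gibbs]
  refine integral_congr_ae (ae_of_all _ fun θ => ?_)
  simp [mul_comm]

theorem norm_sq_sum_spin (J : V → V → ℝ) {ι : Type*} (s : Finset ι) (p : ι → V) :
    ‖∑ i ∈ s, spin J (p i)‖ ^ 2 = 1 / 2 * ∑ i ∈ s, ∑ j ∈ s, twoPoint J (p i) (p j) := by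
  rw [← real_inner_self_eq_norm_sq, sum_inner]
  simp only [inner_sum, inner_spin, Finset.mul_sum]

end TwoPoint

section TorusIncrement

variable {N : ℕ} {β : ℝ}

theorem norm_sum_spin_sub_le [NeZero N] (hβ : 0 < β) (B : Finset (Torus N)) (i : Fin 3) :
    ‖∑ x ∈ B, (spin (torusJ N β) x - spin (torusJ N β) (x + Pi.single i 1))‖ ≤
      √(6 / β * B.card) := by
  refine Real.le_sqrt_of_sq_le ?_
  set g : C(Conf (Torus N), ℝ) :=
    ∑ x ∈ B, (⟨fun θ => (θ x).cos, by fun_prop⟩ -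
      ⟨fun θ => (θ (x + Pi.single i 1)).cos, by fun_prop⟩)
    with hg
  have h1 : ∑ x ∈ B, (spin (torusJ N β) x - spin (torusJ N β) (x + Pi.single i 1)) =
      ContinuousMap.toLp 2 (gibbs (torusJ N β)) ℝ g := by
    simp only [hg, map_sum, map_sub, spin]
  rw [h1, norm_sq_toLp, div_le_iff₀ (integral_exp_energy_pos _)]
  simpa [hg] using torus_integral_sq_le hβ B i

end TorusIncrement

section Lattice

variable {N L : ℕ} {β : ℝ}

theorem mem_interF {x : Site} : x ∈ interF L ↔ ∀ i, -(L : ℤ) + 1 ≤ x i ∧ x i ≤ L - 1 := by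
  simp [interF, Finset.mem_Icc, Pi.le_def, forall_and]

theorem mem_lamF {x : Site} : x ∈ lamF L ↔ ∀ i, -(L : ℤ) ≤ x i ∧ x i ≤ L := by
  simp [lamF, Finset.mem_Icc, Pi.le_def, forall_and]

theorem interF_subset_lamF : interF L ⊆ lamF L := fun x hx => by
  rw [mem_interF] at hx
  exact mem_lamF.2 fun i => by have := hx i; omega

theorem adj_comm {k l : Site} : adj k l ↔ adj l k := by
  simp only [adj, abs_sub_comm]

theorem adj_add_single (k : Site) (i : Fin 3) : adj k (k + Pi.single i 1) := by
  simp only [adj, Pi.add_apply, sub_add_cancel_left, abs_neg]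
  fin_cases i <;> simp [Fin.sum_univ_three]

theorem adj_iff {k l : Site} : adj k l ↔ ∃ i, l = k + Pi.single i 1 ∨ k = l + Pi.single i 1 := by
  constructor
  · intro h
    rw [adj, Fin.sum_univ_three] at h
    have aux : ∀ {a b : Site}, (a = b ↔ a 0 = b 0 ∧ a 1 = b 1 ∧ a 2 = b 2) := by
      intro a b
      rw [funext_iff, Fin.forall_fin_succ, Fin.forall_fin_two]
      rfl
    simp only [Fin.exists_fin_succ, aux]
    simp
    rcases abs_cases (k 0 - l 0) with h0 | h0 <;> rcases abs_cases (k 1 - l 1) with h1 | h1 <;>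
      rcases abs_cases (k 2 - l 2) with h2 | h2 <;> omega
  · rintro ⟨i, rfl | rfl⟩
    · exact adj_add_single _ _
    · exact adj_comm.1 (adj_add_single _ _)

/-- The translate by `c` of the projection of the lattice to the torus. -/
def toTorus (c : Torus N) (k : Site) : Torus N := fun i => c i + (k i : ZMod (2 * N))

theorem toTorus_add_single (c : Torus N) (k : Site) (i : Fin 3) :
    toTorus c (k + Pi.single i 1) = toTorus c k + Pi.single i 1 := by
  ext j
  by_cases h : j = i
  · subst h; simp [toTorus, add_assoc]
  · simp [toTorus, h]

theorem eq_of_toTorus_eq {c : Torus N} {k l : Site} (h : ∀ i, |k i - l i| < 2 * (N : ℤ))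
    (he : toTorus c k = toTorus c l) : k = l := by
  ext i
  have h1 : ((k i : ℤ) : ZMod (2 * N)) = (l i : ℤ) := by
    simpa [toTorus] using congrFun he i
  rw [ZMod.intCast_eq_intCast_iff_dvd_sub] at h1
  have h2 := Int.eq_zero_of_abs_lt_dvd h1 (by
    have := h i
    rw [abs_sub_comm] at this
    exact_mod_cast this)
  omega

theorem toTorus_injOn_lamF (c : Torus N) (hL : L < N) :
    Set.InjOn (toTorus c) (lamF L : Set Site) := fun k hk l hl he => by
  rw [Finset.mem_coe, mem_lamF] at hk hl
  refine eq_of_toTorus_eq (fun i => ?_) he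
  have := hk i
  have := hl i
  rw [abs_lt]
  omega

theorem torusAdj_toTorus_of_adj (c : Torus N) {k l : Site} (h : adj k l) :
    TorusAdj (toTorus c k) (toTorus c l) := by
  obtain ⟨i, rfl | rfl⟩ := adj_iff.1 h
  · exact ⟨i, Or.inl (toTorus_add_single _ _ _)⟩
  · exact ⟨i, Or.inr (toTorus_add_single _ _ _)⟩

theorem exists_adj_of_torusAdj {c : Torus N} {k : Site} (hk : k ∈ interF L) {y : Torus N}
    (h : TorusAdj (toTorus c k) y) : ∃ l ∈ lamF L, adj k l ∧ y = toTorus c l := by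
  rw [mem_interF] at hk
  obtain ⟨i, h | h⟩ := h
  · refine ⟨k + Pi.single i 1, mem_lamF.2 fun j => ?_, adj_add_single _ _, ?_⟩
    · have := hk j
      by_cases hj : j = i
      · subst hj; simp; omega
      · simp [hj]; omega
    · rw [h, toTorus_add_single]
  · have hk' : k = k - Pi.single i 1 + Pi.single i 1 := by simp
    refine ⟨k - Pi.single i 1, mem_lamF.2 fun j => ?_, ?_, ?_⟩
    · have := hk j
      by_cases hj : j = i
      · subst hj; simp; omega
      · simp [hj]; omega
    · rw [adj_comm]
      conv_rhs => rw [hk']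
      exact adj_add_single _ _
    · rw [hk', toTorus_add_single] at h
      exact (add_right_cancel h).symm

theorem torusJ_toTorus (c : Torus N) (hL : L < N) {k l : Site} (hk : k ∈ interF L)
    (hl : l ∈ lamF L) :
    torusJ N β (toTorus c k) (toTorus c l) = if adj k l then β / 6 else 0 := by
  have key : TorusAdj (toTorus c k) (toTorus c l) ↔ adj k l := by
    refine ⟨fun h => ?_, torusAdj_toTorus_of_adj c⟩
    obtain ⟨l', hl', h1, h2⟩ := exists_adj_of_torusAdj hk h
    rwa [toTorus_injOn_lamF c hL hl hl' h2]
  by_cases h : adj k l <;> simp [torusJ, key, h]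

theorem torusJ_comm (x y : Torus N) : torusJ N β x y = torusJ N β y x := by
  by_cases h : TorusAdj x y
  · simp [torusJ, h, torusAdj_comm.1 h]
  · simp [torusJ, h, mt torusAdj_comm.1 h]

theorem sum_torusJ [NeZero N] (c : Torus N) (hL : L < N) {k : Site} (hk : k ∈ interF L)
    (g : Torus N → ℝ) : ∑ y, torusJ N β (toTorus c k) y * g y =
      ∑ l ∈ lamF L, (if adj k l then β / 6 else 0) * g (toTorus c l) := by
  classical
  calc ∑ y, torusJ N β (toTorus c k) y * g y
      = ∑ y ∈ (lamF L).image (toTorus c), torusJ N β (toTorus c k) y * g y := by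
        refine (Finset.sum_subset (Finset.subset_univ _) fun y _ hy => ?_).symm
        by_cases h : TorusAdj (toTorus c k) y
        · obtain ⟨l, hl, -, rfl⟩ := exists_adj_of_torusAdj hk h
          exact absurd (Finset.mem_image_of_mem _ hl) hy
        · simp [torusJ, h]
    _ = _ := by
        rw [Finset.sum_image (toTorus_injOn_lamF c hL)]
        exact Finset.sum_congr rfl fun l hl => by rw [torusJ_toTorus c hL hk hl]

/-- The nearest-neighbour coupling on the interior of a box, with free boundary conditions. -/
def boxJ (L : ℕ) (β : ℝ) (k l : ↥(interF L)) : ℝ := if adj k.1 l.1 then β / 6 else 0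

theorem boxJ_nonneg (hβ : 0 ≤ β) (k l : ↥(interF L)) : 0 ≤ boxJ L β k l := by
  unfold boxJ
  split_ifs <;> positivity

theorem energy0_eq (θ : Cfg L) :
    energy0 L β θ = energy (boxJ L β) fun v => (θ v : Real.Angle) := by
  simp only [energy0, energy, boxJ, Finset.mul_sum, ite_mul, zero_mul, mul_ite, mul_zero,
    ← Real.Angle.coe_sub, Real.Angle.cos_coe]

theorem corr0_eq {x y : Site} (hx : x ∈ interF L) (hy : y ∈ interF L) :
    corr0 L β x y = twoPoint (boxJ L β) ⟨x, hx⟩ ⟨y, hy⟩ := by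
  have h1 := integral_cube (g := fun θ : Conf ↥(interF L) => (θ ⟨x, hx⟩ - θ ⟨y, hy⟩).cos *
    Real.exp (energy (boxJ L β) θ)) (by fun_prop)
  have h2 := integral_cube (g := fun θ : Conf ↥(interF L) => Real.exp (energy (boxJ L β) θ))
    (by fun_prop)
  simp only [← Real.Angle.coe_sub, Real.Angle.cos_coe, ← energy0_eq] at h1 h2
  simp only [corr0, avg0, val, hx, hy, dif_pos, cube, h1, h2, twoPoint]
  rw [mul_div_mul_left _ _ (by positivity)]

theorem corr0_le_one {x y : Site} (hx : x ∈ interF L) (hy : y ∈ interF L) :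
    corr0 L β x y ≤ 1 := by
  rw [corr0_eq hx hy]
  exact twoPoint_le_one _ _ _

theorem corr0_le_torus [NeZero N] (hβ : 0 ≤ β) (hL : L < N) {x y : Site} (hx : x ∈ interF L)
    (hy : y ∈ interF L) (c : Torus N) :
    corr0 L β x y ≤ twoPoint (torusJ N β) (toTorus c x) (toTorus c y) := by
  rw [corr0_eq hx hy]
  refine twoPoint_le_of_injective (ι := fun k : ↥(interF L) => toTorus c k.1) (fun k l h => ?_)
    (boxJ_nonneg hβ) (torusJ_nonneg hβ) (fun k l => ?_) ⟨x, hx⟩ ⟨y, hy⟩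
  · exact Subtype.ext (toTorus_injOn_lamF c hL (interF_subset_lamF k.2) (interF_subset_lamF l.2) h)
  · rw [torusJ_toTorus c hL k.2 (interF_subset_lamF l.2), boxJ]

/-- The energy with plus boundary conditions, as a function of angles. -/
def plusEnergy (L : ℕ) (β : ℝ) (η : Conf ↥(interF L)) : ℝ :=
  energy (boxJ L β) η + β / 3 * ∑ k : ↥(interF L), (nBd L k.1 : ℝ) * (η k).cos

@[fun_prop]
theorem continuous_plusEnergy : Continuous (plusEnergy L β) := by
  unfold plusEnergy
  fun_prop

theorem energyP_eq (θ : Cfg L) :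
    energyP L β θ = plusEnergy L β fun v => (θ v : Real.Angle) := by
  simp only [energyP, plusEnergy, energy0_eq, Real.Angle.cos_coe]

theorem magAt_eq {x : Site} (hx : x ∈ interF L) :
    magAt L β x = (∫ η, (η ⟨x, hx⟩).cos * Real.exp (plusEnergy L β η)) /
      ∫ η, Real.exp (plusEnergy L β η) := by
  have h1 := integral_cube (g := fun θ : Conf ↥(interF L) => (θ ⟨x, hx⟩).cos *
    Real.exp (plusEnergy L β θ)) (by fun_prop)
  have h2 := integral_cube (g := fun θ : Conf ↥(interF L) => Real.exp (plusEnergy L β θ))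
    (by fun_prop)
  simp only [Real.Angle.cos_coe, ← energyP_eq] at h1 h2
  simp only [magAt, avgP, val, hx, dif_pos, cube, h1, h2]
  rw [mul_div_mul_left _ _ (by positivity)]

/-- Pinning the torus off a box yields the box with plus boundary conditions. -/
theorem energy_glue_eq [NeZero N] (c : Torus N) (hL : L < N) : ∃ C : ℝ, ∀ θ : Conf (Torus N),
    energy (torusJ N β) (glue ((interF L).image (toTorus c)) θ 0) =
      C + plusEnergy L β fun k => θ (toTorus c k.1) := by
  classical
  set W := (interF L).image (toTorus c) with hW
  refine ⟨∑ x ∈ Wᶜ, ∑ y ∈ Wᶜ, torusJ N β x y, fun θ => ?_⟩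
  set η := glue W θ 0 with hη
  have hin : ∀ x ∈ W, η x = θ x := fun x hx => by simp [hη, glue, hx]
  have hout : ∀ x ∉ W, η x = 0 := fun x hx => by simp [hη, glue, hx]
  have hmem : ∀ l ∈ interF L, toTorus c l ∈ W := fun l hl => Finset.mem_image_of_mem _ hl
  have hnot : ∀ l ∈ lamF L \ interF L, toTorus c l ∉ W := fun l hl h => by
    obtain ⟨l', hl', h⟩ := Finset.mem_image.1 h
    rw [Finset.mem_sdiff] at hl
    rw [toTorus_injOn_lamF c hL (interF_subset_lamF hl') hl.1 h] at hl'
    exact hl.2 hl'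
  have hsymm : ∑ x ∈ Wᶜ, ∑ y ∈ W, torusJ N β x y * (η x - η y).cos =
      ∑ x ∈ W, ∑ y ∈ Wᶜ, torusJ N β x y * (η x - η y).cos := by
    rw [Finset.sum_comm]
    refine Finset.sum_congr rfl fun x _ => Finset.sum_congr rfl fun y _ => ?_
    rw [torusJ_comm, ← neg_sub, Real.Angle.cos_neg]
  have hconst : ∑ x ∈ Wᶜ, ∑ y ∈ Wᶜ, torusJ N β x y * (η x - η y).cos =
      ∑ x ∈ Wᶜ, ∑ y ∈ Wᶜ, torusJ N β x y := by
    refine Finset.sum_congr rfl fun x hx => Finset.sum_congr rfl fun y hy => ?_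
    rw [hout x (Finset.mem_compl.1 hx), hout y (Finset.mem_compl.1 hy)]
    simp
  have hrow : ∀ k ∈ interF L, ∑ y, torusJ N β (toTorus c k) y *
      ((η (toTorus c k) - η y).cos * if y ∈ W then 1 else 2) =
      (∑ l ∈ interF L, (if adj k l then β / 6 else 0) *
        (θ (toTorus c k) - θ (toTorus c l)).cos) +
      β / 3 * (nBd L k * (θ (toTorus c k)).cos) := by
    intro k hk
    rw [sum_torusJ c hL hk, ← Finset.sum_sdiff interF_subset_lamF, add_comm]
    congr 1
    · refine Finset.sum_congr rfl fun l hl => ?_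
      rw [hin _ (hmem k hk), hin _ (hmem l hl), if_pos (hmem l hl), mul_one]
    · rw [nBd, Finset.card_filter, Nat.cast_sum, Finset.sum_mul, Finset.mul_sum]
      refine Finset.sum_congr rfl fun l hl => ?_
      rw [hin _ (hmem k hk), hout _ (hnot l hl), if_neg (hnot l hl), sub_zero]
      by_cases h : adj k l <;> simp [h]
      ring
  calc energy (torusJ N β) η
      = (∑ x ∈ Wᶜ, ∑ y ∈ Wᶜ, torusJ N β x y) + ∑ x ∈ W, ∑ y, torusJ N β x y *
        ((η x - η y).cos * if y ∈ W then 1 else 2) := by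
        have hsplit : ∀ x, ∑ y, torusJ N β x y * ((η x - η y).cos * if y ∈ W then 1 else 2) =
            (∑ y ∈ W, torusJ N β x y * (η x - η y).cos) +
            2 * ∑ y ∈ Wᶜ, torusJ N β x y * (η x - η y).cos := fun x => by
          rw [← Finset.sum_add_sum_compl W, Finset.mul_sum]
          congr 1
          · exact Finset.sum_congr rfl fun y hy => by rw [if_pos hy, mul_one]
          · refine Finset.sum_congr rfl fun y hy => ?_
            rw [if_neg (Finset.mem_compl.1 hy)]
            ring
        simp only [hsplit, Finset.sum_add_distrib, ← Finset.mul_sum]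
        rw [energy, ← Finset.sum_add_sum_compl W]
        simp only [← Finset.sum_add_sum_compl W fun y => torusJ N β _ y * (η _ - η y).cos,
          Finset.sum_add_distrib]
        rw [hsymm, hconst]
        ring
    _ = _ := by
        rw [hW, Finset.sum_image fun k hk l hl => toTorus_injOn_lamF c hL (interF_subset_lamF hk)
          (interF_subset_lamF hl), ← hW, Finset.sum_congr rfl hrow, Finset.sum_add_distrib,
          ← Finset.mul_sum, plusEnergy, energy]
        simp only [boxJ, Finset.sum_coe_sort_eq_attach]
        congr 2
        · rw [← Finset.sum_attach]
          exact Finset.sum_congr rfl fun k _ => (Finset.sum_attach _ _).symm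
        · rw [← Finset.sum_attach]

/-- Distant two-point functions on the torus are bounded by the magnetization of a box. -/
theorem twoPoint_torus_le_magAt [NeZero N] (hβ : 0 ≤ β) (hL0 : 0 < L) (hL : L < N) {a b : Torus N}
    (hb : b ∉ (interF L).image (toTorus a)) :
    twoPoint (torusJ N β) a b ≤ magAt L β 0 := by
  have h0 : (0 : Site) ∈ interF L := mem_interF.2 fun i => by simp; omega
  have ha0 : toTorus a 0 = a := by ext i; simp [toTorus]
  have ha : a ∈ (interF L).image (toTorus a) := Finset.mem_image.2 ⟨0, h0, ha0⟩
  have key := two_point_le_pinned _ (torusJ_nonneg (N := N) hβ) ha hb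
  obtain ⟨C, hC⟩ := energy_glue_eq (β := β) a hL
  have hinj : Function.Injective fun k : ↥(interF L) => toTorus a k.1 := fun k l h =>
    Subtype.ext (toTorus_injOn_lamF a hL (interF_subset_lamF k.2) (interF_subset_lamF l.2) h)
  have h1 := integral_comp_injective hinj (g := fun η => (η ⟨0, h0⟩).cos *
    Real.exp (plusEnergy L β η)) (by fun_prop)
  have h2 := integral_comp_injective hinj (g := fun η => Real.exp (plusEnergy L β η)) (by fun_prop)
  simp only [ha0] at h1 h2
  simp only [hC, Real.exp_add, mul_left_comm _ (Real.exp C), integral_const_mul, h1, h2] at key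
  have hpos : 0 < ∫ η, Real.exp (plusEnergy L β η) :=
    integral_exp_pos (integrable_of_continuous' (by fun_prop))
  rw [magAt_eq h0, twoPoint, div_le_div_iff₀ (integral_exp_energy_pos _) hpos]
  refine le_of_mul_le_mul_left ?_ (Real.exp_pos C)
  linarith

end Lattice

section Criticality

variable {N L S n : ℕ} {β : ℝ}

/-- The point of the cube `Bn n` with offset `z` from its lowest corner. -/
def cubePoint (n : ℕ) (z : Fin 3 → ℕ) : Site := fun i => (z i : ℤ) - n

theorem cubePoint_add_single (z : Fin 3 → ℕ) (i : Fin 3) :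
    cubePoint n (z + Pi.single i 1) = cubePoint n z + Pi.single i 1 := by
  ext j
  by_cases h : j = i
  · subst h
    simp [cubePoint]
    ring
  · simp [cubePoint, h]

theorem cubePoint_injOn (hS : S ≤ N) :
    Set.InjOn (fun z => toTorus (0 : Torus N) (cubePoint n z)) (box S : Set (Fin 3 → ℕ)) := by
  intro z hz w hw h
  rw [Finset.mem_coe, mem_box] at hz hw
  have := eq_of_toTorus_eq (fun i => ?_) h
  · ext i
    have := congrFun this i
    simp only [cubePoint] at this
    omega
  · have := hz i
    have := hw i
    simp only [cubePoint]
    rw [abs_lt]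
    omega

/-- The spin variables of the torus, indexed by the offset from the lowest corner of `Bn n`. -/
def cubeSpin (N : ℕ) [NeZero N] (β : ℝ) (n : ℕ) (z : Fin 3 → ℕ) : Lp ℝ 2 (gibbs (torusJ N β)) :=
  spin (torusJ N β) (toTorus 0 (cubePoint n z))

theorem incrementBound_cubeSpin [NeZero N] (hβ : 0 < β) (hS : S ≤ N) :
    IncrementBound (cubeSpin N β n) (6 / β) S := by
  classical
  intro B hB i
  have hinj : Set.InjOn (fun z => toTorus (0 : Torus N) (cubePoint n z)) (B : Set (Fin 3 → ℕ)) :=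
    (cubePoint_injOn hS).mono hB
  have := norm_sum_spin_sub_le hβ (B.image fun z => toTorus (0 : Torus N) (cubePoint n z)) i
  rw [Finset.sum_image hinj, Finset.card_image_of_injOn hinj] at this
  simpa only [cubeSpin, cubePoint_add_single, toTorus_add_single] using this

theorem norm_sq_boxAvg_cubeSpin [NeZero N] : ‖boxAvg (cubeSpin N β n) S‖ ^ 2 =
    ((S : ℝ) ^ 3)⁻¹ ^ 2 * (1 / 2 * ∑ z ∈ box S, ∑ w ∈ box S,
      twoPoint (torusJ N β) (toTorus 0 (cubePoint n z)) (toTorus 0 (cubePoint n w))) := by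
  rw [boxAvg, norm_smul, mul_pow, Real.norm_eq_abs, sq_abs]
  simp only [cubeSpin]
  rw [norm_sq_sum_spin]

/-- Averages over large boxes are controlled by the magnetization. -/
theorem norm_sq_boxAvg_cubeSpin_le [NeZero N] (hβ : 0 ≤ β) (hS0 : 0 < S) (hS : S ≤ N)
    (hL0 : 0 < L) (hL : L < N) {ε : ℝ} (hε : 0 ≤ ε) (hm : magAt L β 0 ≤ ε) :
    ‖boxAvg (cubeSpin N β n) S‖ ^ 2 ≤ 1 / 2 * (ε + (interF L).card / (S : ℝ) ^ 3) := by
  classical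
  have hrow : ∀ z ∈ box S, ∑ w ∈ box S, twoPoint (torusJ N β) (toTorus 0 (cubePoint n z))
      (toTorus 0 (cubePoint n w)) ≤ (S : ℝ) ^ 3 * ε + (interF L).card := by
    intro z _
    set a := toTorus (0 : Torus N) (cubePoint n z)
    set W := (interF L).image (toTorus a)
    calc _ ≤ ∑ w ∈ box S, (ε + if toTorus 0 (cubePoint n w) ∈ W then 1 else 0) := by
          refine Finset.sum_le_sum fun w _ => ?_
          split_ifs with h
          · linarith [twoPoint_le_one (torusJ N β) a (toTorus 0 (cubePoint n w))]
          · linarith [twoPoint_torus_le_magAt hβ hL0 hL h]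
      _ ≤ _ := by
          rw [Finset.sum_add_distrib, Finset.sum_const, card_box, nsmul_eq_mul, Nat.cast_pow,
            ← Finset.sum_filter, Finset.sum_const, nsmul_eq_mul, mul_one]
          gcongr
          calc _ ≤ W.card := Finset.card_le_card_of_injOn _
                (fun w hw => (Finset.mem_filter.1 hw).2)
                ((cubePoint_injOn hS).mono (Finset.filter_subset _ _))
            _ ≤ _ := Finset.card_image_le
  have hS' : (0 : ℝ) < S := by exact_mod_cast hS0
  rw [norm_sq_boxAvg_cubeSpin]
  calc _ ≤ ((S : ℝ) ^ 3)⁻¹ ^ 2 *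
        (1 / 2 * ∑ z ∈ box S, ((S : ℝ) ^ 3 * ε + (interF L).card)) := by
        gcongr with z hz
        exact hrow z hz
    _ = _ := by
        rw [Finset.sum_const, card_box, nsmul_eq_mul]
        push_cast
        field_simp

theorem sum_Bn (n : ℕ) (g : Site → ℝ) :
    ∑ x ∈ Bn n, g x = ∑ z ∈ box (2 * n + 1), g (cubePoint n z) := by
  symm
  refine Finset.sum_nbij' (cubePoint n) (fun x i => (x i + n).toNat) ?_ ?_ ?_ ?_ ?_
  · intro z hz
    rw [mem_box] at hz
    simp only [Bn, Finset.mem_Icc, Pi.le_def, cubePoint]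
    exact ⟨fun i => by omega, fun i => by have := hz i; omega⟩
  · intro x hx
    simp only [Bn, Finset.mem_Icc, Pi.le_def] at hx
    rw [mem_box]
    intro i
    have := hx.2 i
    omega
  · intro z _
    ext i
    simp [cubePoint]
  · intro x hx
    simp only [Bn, Finset.mem_Icc, Pi.le_def] at hx
    ext i
    have := hx.1 i
    simp only [cubePoint]
    omega
  · simp

theorem card_Bn (n : ℕ) : (Bn n).card = (2 * n + 1) ^ 3 := by
  have := sum_Bn n fun _ => 1
  simp only [Finset.sum_const, nsmul_eq_mul, mul_one, card_box] at this
  exact_mod_cast this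

/-- Where the magnetization vanishes, averaged two-point functions decay at a uniform rate. -/
theorem sum_corr0_le (hβ : 0 < β) (hm : mStar β = 0) (Λ : Site → Site → ℕ)
    (hΛ : ∀ x ∈ Bn n, ∀ y ∈ Bn n, x ∈ interF (Λ x y) ∧ y ∈ interF (Λ x y)) :
    ∑ x ∈ Bn n, ∑ y ∈ Bn n, corr0 (Λ x y) β x y ≤
      1728 / (β * (2 * n + 1)) * ((Bn n).card : ℝ) ^ 2 := by
  set s := 2 * n + 1 with hs
  set A := ∑ x ∈ Bn n, ∑ y ∈ Bn n, corr0 (Λ x y) β x y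
  have hs0 : (0 : ℝ) < s := by rw [hs]; positivity
  suffices h : √(((s : ℝ) ^ 3)⁻¹ ^ 2 * (1 / 2 * A)) ≤ 12 * √(6 / β / s) by
    have h2 := Real.sqrt_le_iff.1 h |>.2
    rw [mul_pow, Real.sq_sqrt (by positivity)] at h2
    have h3 := mul_le_mul_of_nonneg_left h2 (by positivity : 0 ≤ 2 * ((s : ℝ) ^ 3) ^ 2)
    have hs1 : (2 * n + 1 : ℝ) = s := by rw [hs]; push_cast; rfl
    rw [card_Bn, ← hs, hs1]
    push_cast
    calc A = 2 * ((s : ℝ) ^ 3) ^ 2 * (((s : ℝ) ^ 3)⁻¹ ^ 2 * (1 / 2 * A)) := by field_simp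
      _ ≤ _ := h3
      _ = _ := by field_simp; norm_num
  refine le_of_forall_pos_le_add fun δ hδ => ?_
  obtain ⟨_, ⟨L, hL2, rfl⟩, hL⟩ := exists_lt_of_csInf_lt (s := {r | ∃ L, 2 ≤ L ∧ r = magAt L β 0})
    ⟨_, 2, le_rfl, rfl⟩ (show sInf _ < δ ^ 2 from hm.trans_lt (by positivity))
  obtain ⟨k, hk⟩ := pow_unbounded_of_one_lt ((interF L).card / δ ^ 2) (one_lt_two (α := ℝ))
  set S := 2 ^ k * s with hS
  have hS0 : 0 < S := by positivity
  set M := (Bn n ×ˢ Bn n).sup fun p => Λ p.1 p.2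
  set N := S + L + M + 1 with hN
  have : NeZero N := ⟨by omega⟩
  have hsmall : ‖boxAvg (cubeSpin N β n) S‖ ≤ δ := by
    refine abs_le_of_sq_le_sq' ?_ hδ.le |>.2
    refine (norm_sq_boxAvg_cubeSpin_le hβ.le hS0 (by omega) (by omega) (by omega) (sq_nonneg δ)
      hL.le).trans ?_
    have h1 : ((interF L).card : ℝ) / (S : ℝ) ^ 3 ≤ δ ^ 2 := by
      rw [div_le_iff₀ (by positivity)]
      rw [div_lt_iff₀ (by positivity)] at hk
      have h2 : (2 : ℝ) ^ k ≤ (S : ℝ) ^ 3 := by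
        have : 2 ^ k ≤ S ^ 3 := by
          calc 2 ^ k ≤ 2 ^ k * s := Nat.le_mul_of_pos_right _ (by omega)
            _ ≤ S ^ 3 := Nat.le_self_pow (by norm_num) _
        exact_mod_cast this
      nlinarith [sq_nonneg δ]
    linarith
  have hscale := (incrementBound_cubeSpin (n := n) hβ (show S ≤ N by omega)).norm_boxAvg_le
    (by positivity) (show 0 < s by omega) k le_rfl
  rw [← hS] at hscale
  have hA : A ≤ ∑ z ∈ box s, ∑ w ∈ box s,
      twoPoint (torusJ N β) (toTorus 0 (cubePoint n z)) (toTorus 0 (cubePoint n w)) := by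
    rw [← sum_Bn n fun x => ∑ w ∈ box s,
      twoPoint (torusJ N β) (toTorus 0 x) (toTorus 0 (cubePoint n w))]
    refine Finset.sum_le_sum fun x hx => ?_
    rw [← sum_Bn n fun y => twoPoint (torusJ N β) (toTorus 0 x) (toTorus 0 y)]
    refine Finset.sum_le_sum fun y hy => ?_
    have : Λ x y ≤ M := Finset.le_sup (f := fun p : Site × Site => Λ p.1 p.2)
      (Finset.mk_mem_product hx hy)
    exact corr0_le_torus hβ.le (by omega) (hΛ x hx y hy).1 (hΛ x hx y hy).2 0
  calc √(((s : ℝ) ^ 3)⁻¹ ^ 2 * (1 / 2 * A)) ≤ ‖boxAvg (cubeSpin N β n) s‖ := by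
        refine Real.sqrt_le_iff.2 ⟨norm_nonneg _, ?_⟩
        rw [norm_sq_boxAvg_cubeSpin]
        gcongr
    _ ≤ _ := by linarith

end Criticality

section Limit

variable {L n : ℕ} {β : ℝ}

theorem continuous_corr0 {x y : Site} (hx : x ∈ interF L) (hy : y ∈ interF L) :
    Continuous fun β => corr0 L β x y := by
  have key : ∀ g : Conf ↥(interF L) → ℝ, Continuous g →
      Continuous fun β => ∫ θ, g θ * Real.exp (energy (boxJ L β) θ) := by
    intro g hg
    have hJ : ∀ k l, Continuous fun β => boxJ L β k l := fun k l => by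
      unfold boxJ
      split_ifs <;> fun_prop
    have := continuous_parametric_integral_of_continuous (μ := volume)
      (f := fun β θ => g θ * Real.exp (energy (boxJ L β) θ)) (by
        simp only [Function.uncurry_def, energy]
        fun_prop) isCompact_univ
    simpa only [Measure.restrict_univ] using this
  simp only [corr0_eq hx hy, twoPoint]
  refine (key _ (by fun_prop)).div ?_ fun β => (integral_exp_energy_pos _).ne'
  simpa using key (fun _ => 1) (by fun_prop)

theorem mem_interF_iff_supNorm {x : Site} : x ∈ interF L ↔ supNorm x < L := by
  rw [mem_interF, supNorm, Fin.forall_fin_succ, Fin.forall_fin_two]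
  simp only [max_lt_iff, abs_lt]
  constructor
  · rintro ⟨h0, h1, h2⟩
    simp at h0 h1 h2
    omega
  · rintro ⟨h0, h1, h2⟩
    simp
    omega

theorem bddAbove_corr0 (β : ℝ) (x y : Site) :
    BddAbove {r | ∃ L : ℕ, max (supNorm x) (supNorm y) < (L : ℤ) ∧ r = corr0 L β x y} := by
  refine ⟨1, ?_⟩
  rintro _ ⟨L, hL, rfl⟩
  rw [max_lt_iff, ← mem_interF_iff_supNorm, ← mem_interF_iff_supNorm] at hL
  exact corr0_le_one hL.1 hL.2

theorem mem_interF_of_mem_Bn {x : Site} (hx : x ∈ Bn n) : x ∈ interF (n + 1) := by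
  simp only [Bn, Finset.mem_Icc, Pi.le_def] at hx
  rw [mem_interF]
  intro i
  have := hx.1 i
  have := hx.2 i
  push_cast
  omega

theorem exists_corr0_gt (β : ℝ) (x y : Site) {ε : ℝ} (hε : 0 < ε) :
    ∃ L, (x ∈ interF L ∧ y ∈ interF L) ∧ S20 β x y < corr0 L β x y + ε := by
  obtain ⟨_, ⟨L, hL, rfl⟩, h⟩ := exists_lt_of_lt_csSup
    (s := {r | ∃ L : ℕ, max (supNorm x) (supNorm y) < (L : ℤ) ∧ r = corr0 L β x y})
    ⟨_, (max (supNorm x) (supNorm y) + 1).toNat, by omega, rfl⟩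
    (show S20 β x y - ε < sSup _ from sub_lt_self _ hε)
  rw [max_lt_iff, ← mem_interF_iff_supNorm, ← mem_interF_iff_supNorm] at hL
  exact ⟨L, hL, by linarith⟩

theorem sum_S20_nonneg (β : ℝ) (n : ℕ) : 0 ≤ ∑ x ∈ Bn n, ∑ y ∈ Bn n, S20 β x y := by
  calc 0 ≤ 2 * ‖∑ x ∈ (Bn n).attach, spin (boxJ (n + 1) β) ⟨x, mem_interF_of_mem_Bn x.2⟩‖ ^ 2 := by
        positivity
    _ = ∑ x ∈ Bn n, ∑ y ∈ Bn n, corr0 (n + 1) β x y := by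
        rw [norm_sq_sum_spin, ← mul_assoc, ← Finset.sum_attach (Bn n)]
        norm_num
        refine Finset.sum_congr rfl fun x _ => ?_
        rw [← Finset.sum_attach (Bn n)]
        exact Finset.sum_congr rfl fun y _ =>
          (corr0_eq (mem_interF_of_mem_Bn x.2) (mem_interF_of_mem_Bn y.2)).symm
    _ ≤ _ := by
        refine Finset.sum_le_sum fun x hx => Finset.sum_le_sum fun y hy => ?_
        refine le_csSup (bddAbove_corr0 β x y) ⟨n + 1, ?_, rfl⟩
        rw [max_lt_iff, ← mem_interF_iff_supNorm, ← mem_interF_iff_supNorm]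
        exact ⟨mem_interF_of_mem_Bn hx, mem_interF_of_mem_Bn hy⟩

theorem sum_S20_critBeta_le (hbdd : BddAbove {β | 0 < β ∧ mStar β = 0}) (hpos : 0 < critBeta)
    (n : ℕ) : ∑ x ∈ Bn n, ∑ y ∈ Bn n, S20 critBeta x y ≤
      1728 / (critBeta * (2 * n + 1)) * ((Bn n).card : ℝ) ^ 2 := by
  have hne : {β | 0 < β ∧ mStar β = 0}.Nonempty := by
    by_contra h
    rw [Set.not_nonempty_iff_eq_empty] at h
    rw [critBeta, h, Real.sSup_empty] at hpos
    exact lt_irrefl _ hpos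
  obtain ⟨b, -, hb, hmem⟩ := exists_seq_tendsto_sSup hne hbdd
  refine le_of_forall_pos_le_add fun ε hε => ?_
  have hcard : (0 : ℝ) < (Bn n).card := by
    rw [card_Bn]
    positivity
  set δ := ε / ((Bn n).card : ℝ) ^ 2 with hδ
  choose Λ hΛ hlt using fun x y => exists_corr0_gt critBeta x y (show 0 < δ by positivity)
  have hlim : ∑ x ∈ Bn n, ∑ y ∈ Bn n, corr0 (Λ x y) critBeta x y ≤
      1728 / (critBeta * (2 * n + 1)) * ((Bn n).card : ℝ) ^ 2 := by
    refine le_of_tendsto_of_tendsto' (tendsto_finsetSum _ fun x _ => tendsto_finsetSum _ fun y _ =>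
      ((continuous_corr0 (hΛ x y).1 (hΛ x y).2).tendsto critBeta).comp hb)
      ((tendsto_const_nhds.div (hb.mul_const _) ?_).mul_const _)
      fun j => sum_corr0_le (hmem j).1 (hmem j).2 Λ fun x _ y _ => hΛ x y
    exact (mul_pos hpos (by positivity)).ne'
  calc _ ≤ ∑ x ∈ Bn n, ∑ y ∈ Bn n, (corr0 (Λ x y) critBeta x y + δ) :=
        Finset.sum_le_sum fun x _ => Finset.sum_le_sum fun y _ => (hlt x y).le
    _ = (∑ x ∈ Bn n, ∑ y ∈ Bn n, corr0 (Λ x y) critBeta x y) + ε := by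
        simp only [Finset.sum_add_distrib, Finset.sum_const, nsmul_eq_mul]
        rw [hδ]
        field_simp
    _ ≤ _ := by gcongr

end Limit

end XYModel

end

/-- At the critical inverse temperature, the averaged infinite-volume
free-boundary two-point function of the 3d nearest-neighbor XY model vanishes. -/
theorem averaged_two_point_vanishes_at_criticality
    (hbdd : BddAbove {β : ℝ | 0 < β ∧ mStar β = 0}) (hpos : 0 < critBeta) :
    Filter.Tendsto
      (fun n : ℕ => (((Bn n).card : ℝ) ^ 2)⁻¹ * ∑ x ∈ Bn n, ∑ y ∈ Bn n, S20 critBeta x y)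
      Filter.atTop (nhds 0) := by
  have hle := XYModel.sum_S20_critBeta_le hbdd hpos
  have hcard : ∀ n, (0 : ℝ) < (Bn n).card := fun n => by
    rw [XYModel.card_Bn]
    positivity
  refine squeeze_zero (fun n => mul_nonneg (by positivity) (XYModel.sum_S20_nonneg _ n))
    (g := fun n : ℕ => 1728 / (critBeta * (2 * n + 1))) (fun n => ?_) ?_
  · rw [inv_mul_le_iff₀ (pow_pos (hcard n) 2), mul_comm]
    exact hle n
  · exact ((tendsto_atTop_add_const_right _ _
      (tendsto_natCast_atTop_atTop.const_mul_atTop two_pos)).const_mul_atTop hpos).const_div_atTop _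
end

section
/- The lattice Green-type function G decays at infinity: for every ε > 0 there exists R > 0 such that for all v ∈ ℤ³ with ‖v‖ ≥ R one has |G(v)| ≤ ε; that is, G(x,y) → 0 as |x − y| → ∞. -/
open MeasureTheory Real Filter

/-- The sup norm is bounded by the Euclidean norm. -/
lemma pi_norm_le_sqrt_sum_sq {ι : Type*} [Fintype ι] (x : ι → ℝ) :
    ‖x‖ ≤ Real.sqrt (∑ i, x i ^ 2) :=
  (pi_norm_le_iff_of_nonneg (Real.sqrt_nonneg _)).2 fun i => Real.abs_le_sqrt <|
    Finset.single_le_sum (f := fun j => x j ^ 2) (fun j _ => sq_nonneg _) (Finset.mem_univ i)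

/-- The infrared bound `(2/(3π²)) ‖k‖² ≤ 1 - Ĵ(k)` on the cube `[-π,π]³`. -/
lemma mul_norm_sq_le_one_sub_Jhat {k : Fin 3 → ℝ} (hk : k ∈ Qpi) :
    2 / (3 * π ^ 2) * ‖k‖ ^ 2 ≤ 1 - Jhat k := by
  have hcos (i : Fin 3) : Real.cos (k i) ≤ 1 - 2 / π ^ 2 * k i ^ 2 :=
    Real.cos_le_one_sub_mul_cos_sq (abs_le.2 (hk i (Set.mem_univ i)))
  have hnorm : ‖k‖ ^ 2 ≤ k 0 ^ 2 + k 1 ^ 2 + k 2 ^ 2 := by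
    rw [← Fin.sum_univ_three fun i => k i ^ 2]
    exact (Real.le_sqrt (norm_nonneg _) (by positivity)).1 (pi_norm_le_sqrt_sum_sq k)
  calc 2 / (3 * π ^ 2) * ‖k‖ ^ 2
      ≤ 2 / (3 * π ^ 2) * (k 0 ^ 2 + k 1 ^ 2 + k 2 ^ 2) := by gcongr
    _ = (2 / π ^ 2 * k 0 ^ 2 + 2 / π ^ 2 * k 1 ^ 2 + 2 / π ^ 2 * k 2 ^ 2) / 3 := by
      field_simp
    _ ≤ 1 - Jhat k := by
      unfold Jhat
      linarith [hcos 0, hcos 1, hcos 2]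

lemma measurableSet_Qpi : MeasurableSet Qpi :=
  MeasurableSet.univ_pi fun _ => measurableSet_Icc

/-- The function `1/(1 - Ĵ)` is integrable on the cube `[-π,π]³`. -/
lemma integrableOn_inv_one_sub_Jhat : IntegrableOn (fun k => (1 - Jhat k)⁻¹) Qpi := by
  rw [← integrable_indicator_iff measurableSet_Qpi, ← integrableOn_iff_integrable_of_support_subset
    (s := Metric.ball 0 (π + 1))]
  · refine integrableOn_ball_of_norm_le_rpow (C := 3 * π ^ 2 / 2) (α := 2) (by simp)
      (by norm_num) (ae_of_all _ fun k => ?_) ?_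
    · by_cases hk : k ∈ Qpi
      · rw [Set.indicator_of_mem hk, Real.rpow_neg (norm_nonneg _), Real.rpow_two]
        have h := mul_norm_sq_le_one_sub_Jhat hk
        rcases eq_or_ne k 0 with rfl | hk0
        · simp [Jhat]
          norm_num
        · have hpos : 0 < 2 / (3 * π ^ 2) * ‖k‖ ^ 2 := by positivity
          rw [norm_inv, Real.norm_of_nonneg (hpos.le.trans h)]
          calc (1 - Jhat k)⁻¹ ≤ (2 / (3 * π ^ 2) * ‖k‖ ^ 2)⁻¹ := by gcongr
            _ = _ := by rw [mul_inv, inv_div]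
      · rw [Set.indicator_of_notMem hk, norm_zero]
        positivity
    · refine (Measurable.indicator ?_ measurableSet_Qpi).aestronglyMeasurable
      unfold Jhat
      fun_prop
  · refine Set.support_indicator_subset.trans fun k hk => ?_
    rw [mem_ball_zero_iff]
    refine ((pi_norm_le_iff_of_nonneg pi_pos.le).2 fun i => ?_).trans_lt (lt_add_one π)
    exact abs_le.2 (hk i (Set.mem_univ i))

/-- The functional `k ↦ (2π)⁻¹ k·v` on momentum space. -/
noncomputable def frequency (v : Site) : StrongDual ℝ (Fin 3 → ℝ) :=
  (2 * π)⁻¹ • ∑ i, (v i : ℝ) • ContinuousLinearMap.proj i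

lemma frequency_apply (v : Site) (k : Fin 3 → ℝ) :
    frequency v k = (2 * π)⁻¹ * ∑ i, k i * (v i : ℝ) := by
  simp [frequency, mul_comm]

lemma sqrt_sum_sq_le_norm_frequency (v : Site) :
    Real.sqrt (∑ i, (v i : ℝ) ^ 2) ≤ 2 * π * ‖frequency v‖ := by
  set s := Real.sqrt (∑ i, (v i : ℝ) ^ 2)
  have hsq : s ^ 2 = ∑ i, (v i : ℝ) ^ 2 := Real.sq_sqrt (by positivity)
  have hnorm : ‖fun i => (v i : ℝ)‖ ≤ s := pi_norm_le_sqrt_sum_sq _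
  have hle : (2 * π)⁻¹ * s ^ 2 ≤ ‖frequency v‖ * s := by
    calc (2 * π)⁻¹ * s ^ 2 = frequency v fun i => (v i : ℝ) := by
          rw [frequency_apply, hsq]
          simp only [sq]
      _ ≤ ‖frequency v‖ * ‖fun i => (v i : ℝ)‖ :=
          (le_abs_self _).trans ((frequency v).le_opNorm _)
      _ ≤ ‖frequency v‖ * s := by gcongr
  rcases (show 0 ≤ s from Real.sqrt_nonneg _).eq_or_lt with h0 | hpos
  · rw [← h0]
    positivity
  · rw [inv_mul_le_iff₀ (by positivity), sq, ← mul_assoc] at hle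
    exact le_of_mul_le_mul_right hle hpos

/-- `G(v)` is a multiple of the real part of a Fourier integral of `1/(1 - Ĵ)`. -/
lemma green_eq_re_fourier (v : Site) :
    green v = ((2 * π) ^ 3)⁻¹ * (∫ k, Real.fourierChar (-frequency v k) •
      Qpi.indicator (fun k => (((1 - Jhat k)⁻¹ : ℝ) : ℂ)) k).re := by
  have hint : Integrable (Qpi.indicator fun k => (((1 - Jhat k)⁻¹ : ℝ) : ℂ)) :=
    (integrable_indicator_iff measurableSet_Qpi).2 integrableOn_inv_one_sub_Jhat.ofReal
  have hint' : Integrable fun k => Real.fourierChar (-frequency v k) •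
      Qpi.indicator (fun k => (((1 - Jhat k)⁻¹ : ℝ) : ℂ)) k := by
    refine hint.mono (AEStronglyMeasurable.smul ?_ hint.aestronglyMeasurable) ?_
    · exact (continuous_subtype_val.comp (Real.continuous_fourierChar.comp
        (frequency v).continuous.neg)).aestronglyMeasurable
    · exact ae_of_all _ fun k => (Circle.norm_smul _ _).le
  have hre := integral_re hint'
  simp only [RCLike.re_eq_complex_re] at hre
  rw [green, ← hre, ← integral_indicator measurableSet_Qpi]
  congr 2 with k
  by_cases hk : k ∈ Qpi
  · have harg : 2 * π * -frequency v k = -∑ i, k i * (v i : ℝ) := by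
      rw [frequency_apply]
      field_simp
    rw [Set.indicator_of_mem hk, Set.indicator_of_mem hk, Circle.smul_def,
      Real.fourierChar_apply, harg, smul_eq_mul, Complex.re_mul_ofReal,
      Complex.exp_ofReal_mul_I_re, Real.cos_neg, div_eq_mul_inv]
  · simp [hk]

/-- The lattice Green-type function `G` decays at infinity. -/
theorem green_decays_at_infinity :
    ∀ ε > (0 : ℝ), ∃ R > (0 : ℝ), ∀ v : Site,
      R ≤ Real.sqrt (∑ i, ((v i : ℝ)) ^ 2) → |green v| ≤ ε := by
  intro ε hε
  have hlim := tendsto_integral_exp_smul_cocompact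
    (Qpi.indicator fun k => (((1 - Jhat k)⁻¹ : ℝ) : ℂ)) volume
  rw [← Metric.cobounded_eq_cocompact] at hlim
  obtain ⟨r, -, hr⟩ := hasBasis_cobounded_norm.eventually_iff.1
    (hlim.norm.eventually_le_const (u := (2 * π) ^ 3 * ε) (by rw [norm_zero]; positivity))
  refine ⟨2 * π * max r 1, by positivity, fun v hv => ?_⟩
  have hnorm : r ≤ ‖frequency v‖ := (le_max_left r 1).trans <|
    le_of_mul_le_mul_left (hv.trans (sqrt_sum_sq_le_norm_frequency v)) (by positivity)
  rw [green_eq_re_fourier, abs_mul, abs_of_pos (by positivity), inv_mul_le_iff₀ (by positivity)]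
  exact (Complex.abs_re_le_norm _).trans (hr hnorm)
end

section
/- For every β > 0, every n ≥ 1, every L > n, and all x, y ∈ B_n (so that x, y ∈ Λ_L°, identified also with points of the torus T_L), one has 0 ≤ ⟨cos(θ_x − θ_y)⟩_{L,0,β} ≤ ⟨cos(θ_x − θ_y)⟩_{L,P,β}. -/
open MeasureTheory Real Filter

noncomputable section

namespace Ginibre

section Abstract

variable {G : Type*} [TopologicalSpace G] [CompactSpace G] [SecondCountableTopology G]
  [MeasurableSpace G] [BorelSpace G]

/-- A continuous kernel whose quadratic form on continuous functions is nonnegative. -/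
def PosKernel (μ : Measure G) (K : G × G → ℝ) : Prop :=
  Continuous K ∧ ∀ w : G → ℝ, Continuous w → 0 ≤ ∫ z, w z.1 * w z.2 * K z ∂μ.prod μ

/-- A continuous kernel whose pointwise product preserves positivity of kernels. -/
def PosMultiplier (μ : Measure G) (X : G × G → ℝ) : Prop :=
  Continuous X ∧ ∀ K, PosKernel μ K → PosKernel μ fun z => K z * X z

variable {μ : Measure G} [IsFiniteMeasure μ]

lemma integrable_of_continuous {f : G × G → ℝ} (hf : Continuous f) :
    Integrable f (μ.prod μ) :=
  hf.integrable_of_hasCompactSupport (HasCompactSupport.of_compactSpace f)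

omit [CompactSpace G] [BorelSpace G] in
lemma posKernel_one : PosKernel μ fun _ => 1 := by
  refine ⟨continuous_const, fun w _ => ?_⟩
  simp only [mul_one]
  rw [integral_prod_mul (μ := μ) (ν := μ) w w]
  exact mul_self_nonneg _

namespace PosMultiplier

omit [CompactSpace G] [BorelSpace G] in
lemma integral_nonneg {X : G × G → ℝ} (hX : PosMultiplier μ X) : 0 ≤ ∫ z, X z ∂μ.prod μ := by
  simpa using (hX.2 _ posKernel_one).2 (fun _ => 1) continuous_const

omit [CompactSpace G] [SecondCountableTopology G] [BorelSpace G] [IsFiniteMeasure μ] in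
lemma mul {X Y : G × G → ℝ} (hX : PosMultiplier μ X) (hY : PosMultiplier μ Y) :
    PosMultiplier μ fun z => X z * Y z := by
  refine ⟨hX.1.mul hY.1, fun K hK => ?_⟩
  simpa only [mul_assoc] using hY.2 _ (hX.2 _ hK)

lemma add {X Y : G × G → ℝ} (hX : PosMultiplier μ X) (hY : PosMultiplier μ Y) :
    PosMultiplier μ fun z => X z + Y z := by
  refine ⟨hX.1.add hY.1, fun K hK => ⟨hK.1.mul (hX.1.add hY.1), fun w hw => ?_⟩⟩
  have h1 := (hX.2 _ hK).2 w hw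
  have h2 := (hY.2 _ hK).2 w hw
  have hKc := hK.1
  have hXc := hX.1
  have hYc := hY.1
  have h := integral_add (μ := μ.prod μ)
    (integrable_of_continuous (f := fun z => w z.1 * w z.2 * (K z * X z)) (by fun_prop))
    (integrable_of_continuous (f := fun z => w z.1 * w z.2 * (K z * Y z)) (by fun_prop))
  simp only [mul_add]
  rw [h]
  exact add_nonneg h1 h2

omit [CompactSpace G] [SecondCountableTopology G] [BorelSpace G] [IsFiniteMeasure μ] in
lemma tensor {v : G → ℝ} (hv : Continuous v) : PosMultiplier μ fun z => v z.1 * v z.2 := by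
  refine ⟨by fun_prop, fun K hK => ⟨?_, fun w hw => ?_⟩⟩
  · have hKc := hK.1
    fun_prop
  · convert hK.2 (fun a => w a * v a) (hw.mul hv) using 2
    ext z
    ring

omit [CompactSpace G] [SecondCountableTopology G] [BorelSpace G] [IsFiniteMeasure μ] in
lemma const {c : ℝ} (hc : 0 ≤ c) : PosMultiplier μ fun _ => c := by
  simpa [Real.mul_self_sqrt hc] using tensor (μ := μ) (v := fun _ => √c) continuous_const

omit [CompactSpace G] [SecondCountableTopology G] [BorelSpace G] [IsFiniteMeasure μ] in
lemma pow {X : G × G → ℝ} (hX : PosMultiplier μ X) (n : ℕ) :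
    PosMultiplier μ fun z => X z ^ n := by
  induction n with
  | zero => simpa using const (μ := μ) zero_le_one
  | succ n ih => simpa only [pow_succ] using ih.mul hX

lemma sum {ι : Type*} (s : Finset ι) {X : ι → G × G → ℝ}
    (hX : ∀ i ∈ s, PosMultiplier μ (X i)) : PosMultiplier μ fun z => ∑ i ∈ s, X i z := by
  classical
  induction s using Finset.induction_on with
  | empty => simpa using const (μ := μ) le_rfl
  | insert a s ha ih =>
    simp only [Finset.sum_insert ha]
    exact (hX a (by simp)).add (ih fun i hi => hX i (by simp [hi]))

lemma exp {X : G × G → ℝ} (hX : PosMultiplier μ X) :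
    PosMultiplier μ fun z => Real.exp (X z) := by
  have hXc := hX.1
  refine ⟨by fun_prop, fun K hK => ⟨?_, fun w hw => ?_⟩⟩
  · have hKc := hK.1
    fun_prop
  have hKc := hK.1
  have hpartial (n : ℕ) :
      PosMultiplier μ fun z => ∑ k ∈ Finset.range n, X z ^ k / (k.factorial : ℝ) := by
    refine sum _ fun k _ => ?_
    simp only [div_eq_mul_inv]
    exact (hX.pow k).mul (const (by positivity))
  have hlim : Tendsto
      (fun n => ∫ z, w z.1 * w z.2 *
        (K z * ∑ k ∈ Finset.range n, X z ^ k / (k.factorial : ℝ)) ∂μ.prod μ) atTop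
      (nhds (∫ z, w z.1 * w z.2 * (K z * Real.exp (X z)) ∂μ.prod μ)) := by
    refine tendsto_integral_of_dominated_convergence
      (fun z => |w z.1 * w z.2 * K z| * Real.exp |X z|) (fun n => ?_) ?_ (fun n => ?_) ?_
    · exact (integrable_of_continuous (by fun_prop)).aestronglyMeasurable
    · exact integrable_of_continuous (by fun_prop)
    · refine Eventually.of_forall fun z => ?_
      rw [← mul_assoc, norm_mul, Real.norm_eq_abs, Real.norm_eq_abs]
      refine mul_le_mul_of_nonneg_left ?_ (abs_nonneg _)
      refine (Finset.abs_sum_le_sum_abs _ _).trans ?_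
      simp only [abs_div, abs_pow, Nat.abs_cast]
      exact Real.sum_le_exp_of_nonneg (abs_nonneg _) n
    · refine Eventually.of_forall fun z => ?_
      refine Tendsto.const_mul _ (Tendsto.const_mul _ ?_)
      have := NormedSpace.expSeries_div_hasSum_exp (X z)
      rw [← Real.exp_eq_exp_ℝ] at this
      exact this.tendsto_sum_nat
  exact ge_of_tendsto' hlim fun n => ((hpartial n).2 K hK).2 w hw

end PosMultiplier

variable [AddCommGroup G] [IsTopologicalAddGroup G] [μ.IsAddHaarMeasure]

/-- The endomorphism `(φ, ψ) ↦ (φ - ψ, φ + ψ)`. -/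
def rotate (G : Type*) [AddCommGroup G] : G × G →+ G × G where
  toFun z := (z.1 - z.2, z.1 + z.2)
  map_zero' := by simp
  map_add' a b := by
    ext
    · simp only [Prod.fst_add, Prod.snd_add]; abel
    · simp only [Prod.fst_add, Prod.snd_add]; abel

omit [IsFiniteMeasure μ] in
lemma measurePreserving_rotate (hdiv : Function.Surjective fun g : G => g + g) :
    MeasurePreserving (rotate G) (μ.prod μ) (μ.prod μ) := by
  refine AddMonoidHom.measurePreserving ?_ ?_ rfl
  · change Continuous fun z : G × G => (z.1 - z.2, z.1 + z.2)
    fun_prop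
  · rintro ⟨a, b⟩
    obtain ⟨h, hh⟩ := hdiv (b - a)
    refine ⟨(a + h, h), ?_⟩
    have hh' : h + h = b - a := hh
    ext
    · simp [rotate]
    · simp [rotate, add_assoc, hh']

omit [IsFiniteMeasure μ] in
lemma integral_rotate (hdiv : Function.Surjective fun g : G => g + g) {f : G × G → ℝ}
    (hf : Continuous f) :
    ∫ z, f z ∂μ.prod μ = ∫ z, f (z.1 - z.2, z.1 + z.2) ∂μ.prod μ := by
  have h := measurePreserving_rotate (μ := μ) hdiv
  conv_lhs => rw [← h.map_eq]
  exact integral_map h.measurable.aemeasurable hf.aestronglyMeasurable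

variable {ι : Type*} [Fintype ι] {u v : ι → G → ℝ}

/-- First Ginibre inequality, for a finite family of real parts `u` of characters `u + i v`. -/
theorem integral_mul_exp_nonneg (hdiv : Function.Surjective fun g : G => g + g)
    (hu : ∀ i, Continuous (u i)) (hv : ∀ i, Continuous (v i))
    (hsub : ∀ i a b, u i (a - b) = u i a * u i b + v i a * v i b)
    {J : ι → ℝ} (hJ : ∀ i, 0 ≤ J i) (i₀ : ι) :
    0 ≤ ∫ a, u i₀ a * Real.exp (∑ i, J i * u i a) ∂μ := by
  have hchar (i : ι) : PosMultiplier μ fun z => u i (z.1 - z.2) := by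
    simp only [hsub]
    exact (PosMultiplier.tensor (hu i)).add (PosMultiplier.tensor (hv i))
  have hpos : PosMultiplier μ fun z : G × G =>
      u i₀ (z.1 - z.2) * Real.exp (∑ i, J i * u i (z.1 - z.2)) :=
    (hchar i₀).mul (PosMultiplier.sum _ fun i _ => (PosMultiplier.const (hJ i)).mul (hchar i)).exp
  have h := hpos.integral_nonneg
  have hrot := integral_rotate (μ := μ) hdiv
    (f := fun z => (u i₀ z.1 * Real.exp (∑ i, J i * u i z.1)) * 1) (by fun_prop)
  simp only [mul_one] at hrot
  rw [← hrot] at h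
  have hprod := integral_prod_mul (μ := μ) (ν := μ)
    (fun a => u i₀ a * Real.exp (∑ i, J i * u i a)) (fun _ => (1 : ℝ))
  simp only [mul_one] at hprod
  rw [hprod] at h
  refine nonneg_of_mul_nonneg_left h ?_
  simp only [integral_const, smul_eq_mul, mul_one]
  exact ENNReal.toReal_pos (NeZero.ne _) (measure_ne_top _ _)

/-- Second Ginibre inequality: monotonicity of correlations in the couplings, in product form. -/
theorem integral_mul_integral_le (hdiv : Function.Surjective fun g : G => g + g)
    (hu : ∀ i, Continuous (u i)) (hv : ∀ i, Continuous (v i))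
    (hsub : ∀ i a b, u i (a - b) = u i a * u i b + v i a * v i b)
    (hadd : ∀ i a b, u i (a + b) = u i a * u i b - v i a * v i b)
    {J J' : ι → ℝ} (hJ : ∀ i, 0 ≤ J i) (hJJ' : ∀ i, J i ≤ J' i) (i₀ : ι) :
    (∫ a, u i₀ a * Real.exp (∑ i, J i * u i a) ∂μ) * (∫ a, Real.exp (∑ i, J' i * u i a) ∂μ) ≤
      (∫ a, u i₀ a * Real.exp (∑ i, J' i * u i a) ∂μ) *
        ∫ a, Real.exp (∑ i, J i * u i a) ∂μ := by
  have hpos : PosMultiplier μ fun z : G × G =>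
      (2 * (v i₀ z.1 * v i₀ z.2)) * Real.exp (∑ i, ((J' i + J i) * (u i z.1 * u i z.2) +
        (J' i - J i) * (v i z.1 * v i z.2))) := by
    refine ((PosMultiplier.const zero_le_two).mul (PosMultiplier.tensor (hv i₀))).mul
      (PosMultiplier.sum _ fun i _ => ?_).exp
    exact ((PosMultiplier.const (add_nonneg ((hJ i).trans (hJJ' i)) (hJ i))).mul
      (PosMultiplier.tensor (hu i))).add
      ((PosMultiplier.const (sub_nonneg.2 (hJJ' i))).mul (PosMultiplier.tensor (hv i)))
  have h := hpos.integral_nonneg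
  have hrot := integral_rotate (μ := μ) hdiv
    (f := fun z => (u i₀ z.1 * Real.exp (∑ i, J' i * u i z.1)) * Real.exp (∑ i, J i * u i z.2) -
      Real.exp (∑ i, J' i * u i z.1) * (u i₀ z.2 * Real.exp (∑ i, J i * u i z.2))) (by fun_prop)
  have heq : ∀ z : G × G,
      (u i₀ (z.1 - z.2) * Real.exp (∑ i, J' i * u i (z.1 - z.2))) *
          Real.exp (∑ i, J i * u i (z.1 + z.2)) -
        Real.exp (∑ i, J' i * u i (z.1 - z.2)) *
          (u i₀ (z.1 + z.2) * Real.exp (∑ i, J i * u i (z.1 + z.2))) =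
      (2 * (v i₀ z.1 * v i₀ z.2)) * Real.exp (∑ i, ((J' i + J i) * (u i z.1 * u i z.2) +
        (J' i - J i) * (v i z.1 * v i z.2))) := by
    intro z
    have hexp : ∑ i, ((J' i + J i) * (u i z.1 * u i z.2) +
        (J' i - J i) * (v i z.1 * v i z.2)) =
        ∑ i, J' i * u i (z.1 - z.2) + ∑ i, J i * u i (z.1 + z.2) := by
      rw [← Finset.sum_add_distrib]
      refine Finset.sum_congr rfl fun i _ => ?_
      rw [hsub, hadd]
      ring
    rw [hexp, Real.exp_add, hsub i₀, hadd i₀]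
    ring
  simp only [heq] at hrot
  rw [← hrot, integral_sub (integrable_of_continuous (by fun_prop))
    (integrable_of_continuous (by fun_prop)),
    integral_prod_mul (μ := μ) (ν := μ) (fun a => u i₀ a * Real.exp (∑ i, J' i * u i a))
      (fun a => Real.exp (∑ i, J i * u i a)),
    integral_prod_mul (μ := μ) (ν := μ) (fun a => Real.exp (∑ i, J' i * u i a))
      (fun a => u i₀ a * Real.exp (∑ i, J i * u i a))] at h
  linarith

end Abstract

section Torus

instance : Fact (0 < 2 * π) := ⟨Real.two_pi_pos⟩

/-- The circle `ℝ / 2πℤ`. -/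
abbrev Circ : Type := AddCircle (2 * π)

/-- Cosine on the circle. -/
def cosC (a : Circ) : ℝ := Real.Angle.cos a

/-- Sine on the circle. -/
def sinC (a : Circ) : ℝ := Real.Angle.sin a

lemma continuous_cosC : Continuous cosC := Real.Angle.continuous_cos

lemma continuous_sinC : Continuous sinC := Real.Angle.continuous_sin

lemma cosC_add (a b : Circ) : cosC (a + b) = cosC a * cosC b - sinC a * sinC b :=
  Real.Angle.cos_add a b

lemma cosC_sub (a b : Circ) : cosC (a - b) = cosC a * cosC b + sinC a * sinC b := by
  have hc : cosC (-b) = cosC b := Real.Angle.cos_neg b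
  have hs : sinC (-b) = -sinC b := Real.Angle.sin_neg b
  rw [sub_eq_add_neg, cosC_add, hc, hs]
  ring

lemma cosC_coe_sub (s t : ℝ) : cosC ((s : Circ) - (t : Circ)) = Real.cos (s - t) := rfl

variable {V W : Type*} [Fintype V] [Fintype W]

omit [Fintype V] in
lemma surjective_double : Function.Surjective fun φ : V → Circ => φ + φ := by
  intro φ
  have h (a : Circ) : ∃ b : Circ, b + b = a := by
    induction a using QuotientAddGroup.induction_on with
    | H t =>
      refine ⟨((t / 2 : ℝ) : Circ), ?_⟩
      rw [← AddCircle.coe_add, add_halves]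
  choose f hf using h
  exact ⟨fun i => f (φ i), funext fun i => hf (φ i)⟩

lemma setIntegral_cube {F : (V → Circ) → ℝ} (hF : Continuous F) :
    ∫ θ in Set.univ.pi fun _ : V => Set.Icc (0 : ℝ) (2 * π), F (fun i => (θ i : Circ)) =
      ∫ φ, F φ := by
  have hmk : MeasurePreserving (fun t : ℝ => (t : Circ))
      ((volume : Measure ℝ).restrict (Set.Icc 0 (2 * π))) volume := by
    have h := AddCircle.measurePreserving_mk (2 * π) 0
    rwa [zero_add, restrict_Ioc_eq_restrict_Icc] at h
  have h := measurePreserving_pi (fun _ : V => (volume : Measure ℝ).restrict (Set.Icc 0 (2 * π)))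
    (fun _ : V => (volume : Measure Circ)) fun _ => hmk
  rw [volume_pi, volume_pi, Measure.restrict_pi_pi, ← h.map_eq]
  exact (integral_map h.measurable.aemeasurable hF.aestronglyMeasurable).symm

/-- Restriction of configurations along a map of vertex sets. -/
def pullback (e : W → V) : (V → Circ) →+ (W → Circ) where
  toFun φ := φ ∘ e
  map_zero' := rfl
  map_add' _ _ := rfl

lemma exists_integral_pullback {e : W → V} (he : Function.Injective e) :
    ∃ c : ℝ, 0 < c ∧ ∀ F : (W → Circ) → ℝ, Continuous F →
      ∫ φ : V → Circ, F (φ ∘ e) = c * ∫ φ, F φ := by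
  have hcont : Continuous (pullback e) := by
    change Continuous fun φ : V → Circ => φ ∘ e
    fun_prop
  have hsurj : Function.Surjective (pullback e) := he.surjective_comp_right
  have hHaar : ((volume : Measure (V → Circ)).map (pullback e)).IsAddHaarMeasure :=
    Measure.isAddHaarMeasure_map_of_isFiniteMeasure _ _ hcont hsurj
  have hsmul := Measure.isAddLeftInvariant_eq_smul
    ((volume : Measure (V → Circ)).map (pullback e)) (volume : Measure (W → Circ))
  refine ⟨_, Measure.addHaarScalarFactor_pos_of_isAddHaarMeasure
    ((volume : Measure (V → Circ)).map (pullback e)) (volume : Measure (W → Circ)),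
    fun F hF => ?_⟩
  have hmap := integral_map (μ := (volume : Measure (V → Circ))) hcont.measurable.aemeasurable
    (hF.aestronglyMeasurable (μ := (volume : Measure (V → Circ)).map (pullback e)))
  rw [hsmul, integral_smul_nnreal_measure] at hmap
  exact hmap.symm

/-- The cosine of the angle difference along the ordered pair `p`. -/
def cosPair (p : V × V) (φ : V → Circ) : ℝ := cosC (φ p.1 - φ p.2)

omit [Fintype V] in
lemma continuous_cosPair (p : V × V) : Continuous (cosPair p) :=
  continuous_cosC.comp (by fun_prop)

/-- The Boltzmann weight with couplings `J`. -/
def weight (J : V × V → ℝ) (φ : V → Circ) : ℝ := Real.exp (∑ p, J p * cosPair p φ)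

lemma continuous_weight (J : V × V → ℝ) : Continuous (weight J) :=
  Real.continuous_exp.comp (continuous_finsetSum _ fun p _ => (continuous_cosPair p).const_mul _)

lemma integral_weight_pos (J : V × V → ℝ) : 0 < ∫ φ, weight J φ :=
  integral_exp_pos ((continuous_weight J).integrable_of_hasCompactSupport
    (HasCompactSupport.of_compactSpace _))

/-- The two-point function with couplings `J` along the ordered pair `p`. -/
def twoPoint (J : V × V → ℝ) (p : V × V) : ℝ :=
  (∫ φ, cosPair p φ * weight J φ) / ∫ φ, weight J φ

lemma twoPoint_nonneg {J : V × V → ℝ} (hJ : ∀ p, 0 ≤ J p) (p : V × V) : 0 ≤ twoPoint J p := by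
  refine div_nonneg ?_ (integral_weight_pos J).le
  exact integral_mul_exp_nonneg (u := cosPair) (v := fun q φ => sinC (φ q.1 - φ q.2))
    surjective_double continuous_cosPair (fun q => continuous_sinC.comp (by fun_prop))
    (fun q a b => by simp only [cosPair, Pi.sub_apply, sub_sub_sub_comm, cosC_sub (a q.1 - a q.2)])
    hJ p

lemma twoPoint_mono {J J' : V × V → ℝ} (hJ : ∀ p, 0 ≤ J p) (hJJ' : ∀ p, J p ≤ J' p)
    (p : V × V) : twoPoint J p ≤ twoPoint J' p := by
  unfold twoPoint
  rw [div_le_div_iff₀ (integral_weight_pos J) (integral_weight_pos J')]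
  exact integral_mul_integral_le (u := cosPair) (v := fun q φ => sinC (φ q.1 - φ q.2))
    surjective_double continuous_cosPair (fun q => continuous_sinC.comp (by fun_prop))
    (fun q a b => by simp only [cosPair, Pi.sub_apply, sub_sub_sub_comm, cosC_sub (a q.1 - a q.2)])
    (fun q a b => by simp only [cosPair, Pi.add_apply, add_sub_add_comm, cosC_add (a q.1 - a q.2)])
    hJ hJJ' p

/-- Enlarging the vertex set without adding couplings preserves two-point functions. -/
lemma twoPoint_pullback {e : W → V} (he : Function.Injective e) {J : W × W → ℝ}
    {J' : V × V → ℝ} (hJ : ∀ q, J' (e q.1, e q.2) = J q)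
    (hJ' : ∀ p, p ∉ Set.range (Prod.map e e) → J' p = 0) (p : W × W) :
    twoPoint J' (e p.1, e p.2) = twoPoint J p := by
  have hw (φ : V → Circ) : weight J' φ = weight J (φ ∘ e) := by
    unfold weight
    congr 1
    refine (Fintype.sum_of_injective (Prod.map e e) (he.prodMap he) _ _ (fun q hq => ?_)
      fun q => ?_).symm
    · rw [hJ' q hq, zero_mul]
    · rw [← hJ q]
      rfl
  obtain ⟨c, hc, h⟩ := exists_integral_pullback he
  have hn := h (fun φ => cosPair p φ * weight J φ)
    ((continuous_cosPair p).mul (continuous_weight J))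
  have hd := h (weight J) (continuous_weight J)
  unfold twoPoint
  simp only [hw]
  rw [hd, ← mul_div_mul_left (∫ φ, cosPair p φ * weight J φ) _ hc.ne', ← hn]
  rfl

end Torus

section Lattice

/-- Free couplings. -/
def coupling0 (L : ℕ) (β : ℝ) (p : interF L × interF L) : ℝ :=
  if adj p.1.1 p.2.1 then β / 6 else 0

/-- Periodic couplings. -/
def couplingT (L : ℕ) (β : ℝ) (p : torF L × torF L) : ℝ :=
  if adjT L p.1.1 p.2.1 then β / 6 else 0

/-- Free couplings, viewed on the torus. -/
def coupling0T (L : ℕ) (β : ℝ) (p : torF L × torF L) : ℝ :=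
  if p.1.1 ∈ interF L ∧ p.2.1 ∈ interF L ∧ adj p.1.1 p.2.1 then β / 6 else 0

lemma interF_subset_torF (L : ℕ) : interF L ⊆ torF L := by
  intro x hx
  simp only [interF, torF, Finset.mem_Icc, Pi.le_def] at hx ⊢
  exact ⟨fun i => by have := hx.1 i; omega, hx.2⟩

lemma Bn_subset_interF {n L : ℕ} (hL : n < L) : Bn n ⊆ interF L := by
  intro x hx
  simp only [interF, Bn, Finset.mem_Icc, Pi.le_def] at hx ⊢
  exact ⟨fun i => by have := hx.1 i; omega, fun i => by have := hx.2 i; omega⟩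

lemma torDist_eq_abs {L : ℕ} (hL : 2 ≤ L) {m : ℤ} (hm : |m| ≤ 1) : torDist L m = |m| := by
  rw [abs_le] at hm
  have hcases : m = -1 ∨ m = 0 ∨ m = 1 := by omega
  unfold torDist
  rcases hcases with rfl | rfl | rfl
  · have h : (-1 : ℤ) % (2 * L) = 2 * L - 1 := by
      rw [← Int.add_emod_right, Int.emod_eq_of_lt] <;> omega
    rw [h, abs_neg, abs_one]
    omega
  · simp
  · have h : (1 : ℤ) % (2 * L) = 1 := Int.emod_eq_of_lt (by omega) (by omega)
    rw [h, abs_one]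
    omega

lemma adjT_of_adj {L : ℕ} (hL : 2 ≤ L) {k l : Site} (h : adj k l) : adjT L k l := by
  unfold adjT
  unfold adj at h
  rw [← h]
  refine Finset.sum_congr rfl fun i _ => torDist_eq_abs hL ?_
  rw [← h]
  exact Finset.single_le_sum (f := fun i => |k i - l i|) (fun j _ => abs_nonneg _)
    (Finset.mem_univ i)

lemma corr0_eq_twoPoint {L : ℕ} (β : ℝ) {x y : Site} (hx : x ∈ interF L) (hy : y ∈ interF L) :
    corr0 L β x y = twoPoint (coupling0 L β) (⟨x, hx⟩, ⟨y, hy⟩) := by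
  have hE (θ : Cfg L) : Real.exp (energy0 L β θ) =
      weight (coupling0 L β) fun i => (θ i : Circ) := by
    simp only [weight, energy0, coupling0, cosPair, cosC_coe_sub, Fintype.sum_prod_type,
      Finset.mul_sum, mul_ite, ite_mul, mul_zero, zero_mul]
  unfold corr0 avg0 twoPoint
  rw [← setIntegral_cube (F := fun φ => cosPair _ φ * weight (coupling0 L β) φ)
    ((continuous_cosPair _).mul (continuous_weight _)), ← setIntegral_cube (continuous_weight _)]
  simp only [hE, cosPair, cosC_coe_sub, val, dif_pos hx, dif_pos hy]
  rfl

lemma corrT_eq_twoPoint {L : ℕ} (β : ℝ) {x y : Site} (hx : x ∈ torF L) (hy : y ∈ torF L) :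
    corrT L β x y = twoPoint (couplingT L β) (⟨x, hx⟩, ⟨y, hy⟩) := by
  have hE (θ : TCfg L) : Real.exp (energyT L β θ) =
      weight (couplingT L β) fun i => (θ i : Circ) := by
    simp only [weight, energyT, couplingT, cosPair, cosC_coe_sub, Fintype.sum_prod_type,
      Finset.mul_sum, mul_ite, ite_mul, mul_zero, zero_mul]
  unfold corrT avgT twoPoint
  rw [← setIntegral_cube (F := fun φ => cosPair _ φ * weight (couplingT L β) φ)
    ((continuous_cosPair _).mul (continuous_weight _)), ← setIntegral_cube (continuous_weight _)]
  simp only [hE, cosPair, cosC_coe_sub, valT, dif_pos hx, dif_pos hy]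
  rfl

lemma twoPoint_coupling0T (L : ℕ) (β : ℝ) (p : interF L × interF L) :
    twoPoint (coupling0T L β)
      (⟨p.1.1, interF_subset_torF L p.1.2⟩, ⟨p.2.1, interF_subset_torF L p.2.2⟩) =
      twoPoint (coupling0 L β) p := by
  refine twoPoint_pullback (e := fun k : interF L => (⟨k.1, interF_subset_torF L k.2⟩ : torF L))
    (fun a b h => Subtype.ext (congrArg (fun k : torF L => k.1) h)) (fun q => ?_)
    (fun q hq => ?_) p
  · simp [coupling0T, coupling0]
  · refine if_neg fun h => hq ⟨(⟨q.1.1, h.1⟩, ⟨q.2.1, h.2.1⟩), rfl⟩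

end Lattice

end Ginibre

end

/-- Ginibre comparison of free and periodic boundary conditions. -/
theorem free_le_periodic_two_point
    (β : ℝ) (hβ : 0 < β) (n : ℕ) (hn : 1 ≤ n) (L : ℕ) (hL : n < L)
    (x y : Site) (hx : x ∈ Bn n) (hy : y ∈ Bn n) :
    0 ≤ corr0 L β x y ∧ corr0 L β x y ≤ corrT L β x y := by
  have hx' := Ginibre.Bn_subset_interF hL hx
  have hy' := Ginibre.Bn_subset_interF hL hy
  have h0 (p) : 0 ≤ Ginibre.coupling0T L β p := by
    unfold Ginibre.coupling0T
    split_ifs <;> positivity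
  have hle (p) : Ginibre.coupling0T L β p ≤ Ginibre.couplingT L β p := by
    unfold Ginibre.coupling0T Ginibre.couplingT
    split_ifs with h h'
    · exact le_rfl
    · exact absurd (Ginibre.adjT_of_adj (by omega) h.2.2) h'
    · positivity
    · exact le_rfl
  rw [Ginibre.corr0_eq_twoPoint β hx' hy',
    Ginibre.corrT_eq_twoPoint β (Ginibre.interF_subset_torF L hx')
      (Ginibre.interF_subset_torF L hy'), ← Ginibre.twoPoint_coupling0T]
  exact ⟨Ginibre.twoPoint_nonneg h0 _, Ginibre.twoPoint_mono h0 hle _⟩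
end

section
/- For every β > 0 and all x, y ∈ ℤ³, the free-boundary two-point function is nondecreasing in the volume: if max(‖x‖_∞, ‖y‖_∞) < L ≤ L′ then ⟨cos(θ_x − θ_y)⟩_{L,0,β} ≤ ⟨cos(θ_x − θ_y)⟩_{L′,0,β}. -/
open MeasureTheory Real Filter

section Ginibre

variable {X : Type*} [TopologicalSpace X]

/-- The continuous functions on `X × X` of the form `(a, b) ↦ g a * g b`. -/
def diagonalProducts (X : Type*) [TopologicalSpace X] : Submonoid C(X × X, ℝ) where
  carrier := {f | ∃ g : C(X, ℝ), ∀ p, f p = g p.1 * g p.2}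
  one_mem' := ⟨1, by simp⟩
  mul_mem' := by
    rintro f f' ⟨g, hg⟩ ⟨g', hg'⟩
    exact ⟨g * g', fun p => by simp only [ContinuousMap.mul_apply, hg, hg']; ring⟩

/-- The closed semiring of functions on `X × X` generated by the diagonal products. -/
def diagonalCone (X : Type*) [TopologicalSpace X] [CompactSpace X] : Subsemiring C(X × X, ℝ) :=
  (diagonalProducts X).subsemiringClosure.topologicalClosure

variable [CompactSpace X]

theorem mem_diagonalCone_of_eq {f : C(X × X, ℝ)} (g : C(X, ℝ))
    (hg : ∀ p, f p = g p.1 * g p.2) : f ∈ diagonalCone X :=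
  Subsemiring.le_topologicalClosure _ (AddSubmonoid.subset_closure ⟨g, hg⟩)

theorem smul_mem_diagonalCone {f : C(X × X, ℝ)} (hf : f ∈ diagonalCone X) {r : ℝ} (hr : 0 ≤ r) :
    r • f ∈ diagonalCone X := by
  have hc : ContinuousMap.const (X × X) r ∈ diagonalCone X :=
    mem_diagonalCone_of_eq (ContinuousMap.const X (√r)) fun p => by simp [Real.mul_self_sqrt hr]
  have : r • f = ContinuousMap.const (X × X) r * f := by ext p; simp
  exact this ▸ mul_mem hc hf

theorem exp_mem_diagonalCone {f : C(X × X, ℝ)} (hf : f ∈ diagonalCone X) :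
    NormedSpace.exp f ∈ diagonalCone X := by
  have h := NormedSpace.exp_series_hasSum_exp' (𝕂 := ℝ) f
  refine (Subsemiring.isClosed_topologicalClosure _).mem_of_tendsto h (Eventually.of_forall ?_)
  exact fun s => sum_mem fun n _ => smul_mem_diagonalCone (pow_mem hf n) (by positivity)

theorem ContinuousMap.exp_apply (f : C(X, ℝ)) (p : X) :
    (NormedSpace.exp f) p = Real.exp (f p) := by
  have := NormedSpace.map_exp (ContinuousMap.evalAlgHom ℝ ℝ p)
    (continuous_eval_const p) f
  rw [Real.exp_eq_exp_ℝ]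
  exact this

variable [SecondCountableTopology X] [MeasurableSpace X] [BorelSpace X]

theorem integral_nonneg_of_mem_diagonalCone (μ : Measure X) [IsFiniteMeasure μ]
    {f : C(X × X, ℝ)} (hf : f ∈ diagonalCone X) : 0 ≤ ∫ p, f p ∂(μ.prod μ) := by
  have hint (f : C(X × X, ℝ)) : Integrable f (μ.prod μ) :=
    f.continuous.integrable_of_hasCompactSupport (HasCompactSupport.of_compactSpace _)
  have hcont : Continuous fun f : C(X × X, ℝ) => ∫ p, f p ∂(μ.prod μ) := by
    refine continuous_iff_continuousAt.2 fun f => ?_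
    refine tendsto_integral_filter_of_norm_le_const ?_ ⟨‖f‖ + 1, ?_⟩ ?_
    · exact Eventually.of_forall fun g => (hint g).aestronglyMeasurable
    · filter_upwards [(continuous_norm.tendsto f).eventually (ge_mem_nhds (lt_add_one ‖f‖))]
        with g hg
      exact ae_of_all _ fun p => (g.norm_coe_le_norm p).trans hg
    · exact ae_of_all _ fun p => (continuous_eval_const p).tendsto f
  refine closure_minimal (s := ((diagonalProducts X).subsemiringClosure : Set C(X × X, ℝ)))
    (t := {f | 0 ≤ ∫ p, f p ∂(μ.prod μ)}) (fun f hf => ?_) (isClosed_le continuous_const hcont) hf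
  change f ∈ AddSubmonoid.closure (diagonalProducts X : Set C(X × X, ℝ)) at hf
  induction hf using AddSubmonoid.closure_induction with
  | mem f hf =>
    obtain ⟨g, hg⟩ := hf
    simp only [Set.mem_ofPred_eq, hg, integral_prod_mul]
    exact mul_self_nonneg _
  | zero => simp
  | add f g _ _ hf hg =>
    simp only [Set.mem_ofPred_eq, ContinuousMap.add_apply] at hf hg ⊢
    rw [integral_add (hint f) (hint g)]
    exact add_nonneg hf hg

variable [AddCommGroup X] [IsTopologicalAddGroup X]

/-- On a compact group divisible by two, `(a, b) ↦ (a - b, a + b)` preserves Haar measure. -/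
theorem measurePreserving_sub_add (μ : Measure X) [μ.IsAddHaarMeasure]
    (h2 : Function.Surjective fun x : X => x + x) :
    MeasurePreserving (fun p : X × X => (p.1 - p.2, p.1 + p.2)) (μ.prod μ) (μ.prod μ) := by
  let φ : X × X →+ X × X :=
    (AddMonoidHom.fst X X - AddMonoidHom.snd X X).prod (AddMonoidHom.fst X X + AddMonoidHom.snd X X)
  refine AddMonoidHom.measurePreserving (f := φ) ?_ ?_ rfl
  · change Continuous fun p : X × X => (p.1 - p.2, p.1 + p.2)
    fun_prop
  · rintro ⟨p, q⟩
    obtain ⟨b, hb⟩ := h2 (q - p)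
    refine ⟨(p + b, b), Prod.ext (add_sub_cancel_right p b) ?_⟩
    change p + b + b = q
    rw [add_assoc, show b + b = q - p from hb, add_sub_cancel]

/-- **Ginibre's inequality**: with nonnegative couplings to cosines of characters, expectations of
such cosines increase with the couplings. -/
theorem ginibre_mono {E : Type*} [Fintype E] (μ : Measure X) [μ.IsAddHaarMeasure]
    (h2 : Function.Surjective fun x : X => x + x) (c s : E → C(X, ℝ))
    (hadd : ∀ e x y, c e (x + y) = c e x * c e y - s e x * s e y)
    (hsub : ∀ e x y, c e (x - y) = c e x * c e y + s e x * s e y)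
    (J K : E → ℝ) (hJ : ∀ e, 0 ≤ J e) (hJK : ∀ e, J e ≤ K e) (e : E) :
    (∫ x, c e x * Real.exp (∑ i, J i * c i x) ∂μ) * ∫ x, Real.exp (∑ i, K i * c i x) ∂μ ≤
      (∫ x, c e x * Real.exp (∑ i, K i * c i x) ∂μ) * ∫ x, Real.exp (∑ i, J i * c i x) ∂μ := by
  let d (f : C(X, ℝ)) : C(X × X, ℝ) := f.comp ContinuousMap.fst * f.comp ContinuousMap.snd
  have hd (f : C(X, ℝ)) : d f ∈ diagonalCone X := mem_diagonalCone_of_eq f fun _ => rfl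
  let H : C(X × X, ℝ) := ∑ i, ((K i + J i) • d (c i) + (K i - J i) • d (s i))
  have hH : H ∈ diagonalCone X := sum_mem fun i _ => add_mem
    (smul_mem_diagonalCone (hd _) (by linarith [hJ i, hJK i]))
    (smul_mem_diagonalCone (hd _) (by linarith [hJK i]))
  have hpos := integral_nonneg_of_mem_diagonalCone μ
    (mul_mem (smul_mem_diagonalCone (hd (s e)) zero_le_two) (exp_mem_diagonalCone hH))
  let F : X × X → ℝ := fun p =>
    (c e p.1 * Real.exp (∑ i, K i * c i p.1)) * Real.exp (∑ i, J i * c i p.2) -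
      Real.exp (∑ i, K i * c i p.1) * (c e p.2 * Real.exp (∑ i, J i * c i p.2))
  have hF : ∫ p, F p ∂(μ.prod μ) =
      ∫ p, ((2 : ℝ) • d (s e) * NormedSpace.exp H) p ∂(μ.prod μ) := by
    have hmp := measurePreserving_sub_add μ h2
    have hFc : Continuous F := by fun_prop
    rw [← hmp.map_eq, integral_map hmp.measurable.aemeasurable hFc.aestronglyMeasurable,
      hmp.map_eq]
    refine integral_congr_ae (ae_of_all _ fun p => ?_)
    have hexp : Real.exp (∑ i, K i * c i (p.1 - p.2)) * Real.exp (∑ i, J i * c i (p.1 + p.2)) =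
        Real.exp (H p) := by
      rw [← Real.exp_add, ← Finset.sum_add_distrib]
      simp only [H, d, ContinuousMap.sum_apply, ContinuousMap.add_apply, ContinuousMap.smul_apply,
        ContinuousMap.mul_apply, ContinuousMap.comp_apply, ContinuousMap.fst_apply,
        ContinuousMap.snd_apply, smul_eq_mul, hadd, hsub]
      congr 1
      exact Finset.sum_congr rfl fun i _ => by ring
    have hdiff : c e (p.1 - p.2) - c e (p.1 + p.2) = ((2 : ℝ) • d (s e)) p := by
      simp only [hadd, hsub, d, ContinuousMap.smul_apply,
        ContinuousMap.mul_apply, ContinuousMap.comp_apply, ContinuousMap.fst_apply,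
        ContinuousMap.snd_apply, smul_eq_mul]
      ring
    rw [ContinuousMap.mul_apply, ContinuousMap.exp_apply, ← hexp, ← hdiff]
    simp only [F]
    ring
  have hint {f : X × X → ℝ} (hf : Continuous f) : Integrable f (μ.prod μ) :=
    hf.integrable_of_hasCompactSupport (HasCompactSupport.of_compactSpace _)
  rw [← hF, integral_sub (hint (by fun_prop)) (hint (by fun_prop)),
    integral_prod_mul (fun x => c e x * Real.exp (∑ i, K i * c i x))
      (fun x => Real.exp (∑ i, J i * c i x)),
    integral_prod_mul (fun x => Real.exp (∑ i, K i * c i x))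
      (fun x => c e x * Real.exp (∑ i, J i * c i x))] at hpos
  linarith

end Ginibre

section Torus

instance : Fact (0 < 2 * π) := ⟨two_pi_pos⟩

/-- The circle of angles modulo `2π`. -/
abbrev Ang : Type := AddCircle (2 * π)

instance : SecondCountableTopology Ang :=
  inferInstanceAs (SecondCountableTopology (ℝ ⧸ AddSubgroup.zmultiples (2 * π)))

theorem toCircle_coe_re (t : ℝ) : (AddCircle.toCircle (t : Ang) : ℂ).re = Real.cos t := by
  rw [AddCircle.toCircle_apply_mk, div_self two_pi_pos.ne', one_mul, Circle.coe_exp,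
    Complex.exp_ofReal_mul_I_re]

variable {ι : Type*}

/-- The cosine `cos (θ k - θ l)` of an angle difference on the torus. -/
noncomputable def cosDiff (e : ι × ι) : C(ι → Ang, ℝ) where
  toFun θ := ((θ e.1 - θ e.2).toCircle : ℂ).re
  continuous_toFun := by
    have := AddCircle.continuous_toCircle (T := 2 * π)
    fun_prop

/-- The sine `sin (θ k - θ l)` of an angle difference on the torus. -/
noncomputable def sinDiff (e : ι × ι) : C(ι → Ang, ℝ) where
  toFun θ := ((θ e.1 - θ e.2).toCircle : ℂ).im
  continuous_toFun := by
    have := AddCircle.continuous_toCircle (T := 2 * π)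
    fun_prop

theorem cosDiff_add (e : ι × ι) (θ φ : ι → Ang) :
    cosDiff e (θ + φ) = cosDiff e θ * cosDiff e φ - sinDiff e θ * sinDiff e φ := by
  simp [cosDiff, sinDiff, add_sub_add_comm, AddCircle.toCircle_add]

theorem cosDiff_sub (e : ι × ι) (θ φ : ι → Ang) :
    cosDiff e (θ - φ) = cosDiff e θ * cosDiff e φ + sinDiff e θ * sinDiff e φ := by
  have h : θ e.1 - φ e.1 - (θ e.2 - φ e.2) = θ e.1 - θ e.2 + -(φ e.1 - φ e.2) := by abel
  simp [cosDiff, sinDiff, h, AddCircle.toCircle_add, AddCircle.toCircle_neg, -neg_sub]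

theorem surjective_add_self_ang : Function.Surjective fun θ : ι → Ang => θ + θ := by
  intro θ
  choose t ht using fun i => QuotientAddGroup.mk_surjective (θ i)
  refine ⟨fun i => ((t i / 2 : ℝ) : Ang), funext fun i => ?_⟩
  change ((t i / 2 : ℝ) : Ang) + ((t i / 2 : ℝ) : Ang) = θ i
  rw [← AddCircle.coe_add, add_halves]
  exact ht i

variable [Fintype ι]

/-- Integrals of periodic functions over `[0, 2π]^ι` are integrals over the torus. -/
theorem setIntegral_cube_eq_integral_torus {F : (ι → Ang) → ℝ} (hF : Continuous F) :
    ∫ θ in Set.univ.pi fun _ : ι => Set.Icc 0 (2 * π), F (fun i => (θ i : Ang)) =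
      ∫ θ, F θ := by
  have hmp : MeasurePreserving (fun (θ : ι → ℝ) i => (θ i : Ang))
      (volume.restrict (Set.univ.pi fun _ : ι => Set.Icc 0 (2 * π))) volume := by
    rw [volume_pi, volume_pi, Measure.restrict_pi_pi]
    refine measurePreserving_pi _ _ fun _ => ?_
    have h := AddCircle.measurePreserving_mk (2 * π) 0
    rw [zero_add] at h
    rwa [← Measure.restrict_congr_set (Ioc_ae_eq_Icc (μ := volume))]
  rw [← hmp.map_eq, integral_map hmp.measurable.aemeasurable hF.aestronglyMeasurable]

theorem integral_torus_comp {κ : Type*} [Fintype κ] {f : ι → κ} (hf : Function.Injective f) :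
    ∃ r : ℝ, r ≠ 0 ∧ ∀ F : (ι → Ang) → ℝ, Continuous F →
      ∫ θ : κ → Ang, F (θ ∘ f) = r * ∫ θ, F θ := by
  let φ : (κ → Ang) →+ (ι → Ang) :=
    { toFun := fun θ => θ ∘ f, map_zero' := rfl, map_add' := fun _ _ => rfl }
  have hφ : Continuous φ := continuous_pi fun i => continuous_apply (f i)
  have : (Measure.map φ volume).IsAddHaarMeasure :=
    Measure.isAddHaarMeasure_map_of_isFiniteMeasure volume φ hφ hf.surjective_comp_right
  have hμ := Measure.isAddLeftInvariant_eq_smul (Measure.map φ volume)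
    (volume : Measure (ι → Ang))
  set r := (Measure.map φ volume).addHaarScalarFactor (volume : Measure (ι → Ang)) with hr
  refine ⟨r, NNReal.coe_ne_zero.2
    (Measure.addHaarScalarFactor_pos_of_isAddHaarMeasure _ _).ne', fun F hF => ?_⟩
  have h := integral_map (μ := volume) hφ.measurable.aemeasurable
    (hF.aestronglyMeasurable (μ := Measure.map φ volume))
  rw [hμ, integral_smul_nnreal_measure] at h
  exact h.symm

end Torus

theorem mem_interF {L : ℕ} {x : Site} (hx : supNorm x < (L : ℤ)) : x ∈ interF L := by
  simp only [supNorm, max_lt_iff, abs_lt] at hx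
  simp only [interF, Finset.mem_Icc, Pi.le_def, Fin.forall_fin_succ]
  simp
  omega

theorem interF_mono {L L' : ℕ} (h : L ≤ L') : interF L ⊆ interF L' :=
  Finset.Icc_subset_Icc (fun _ => by dsimp; omega) (fun _ => by dsimp; omega)

/-- The coupling of the box of size `L`, on pairs of sites. -/
noncomputable def coupling (L : ℕ) (β : ℝ) (e : Site × Site) : ℝ :=
  if e.1 ∈ interF L ∧ e.2 ∈ interF L ∧ adj e.1 e.2 then β / 6 else 0

/-- The two-point function of a box as a ratio of torus integrals over a larger box. -/
theorem corr0_eq_integral_torus {L L' : ℕ} (h : L ≤ L') (β : ℝ) (x y : interF L) :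
    corr0 L β x y =
      (∫ θ : interF L' → Ang,
        cosDiff (⟨x, interF_mono h x.2⟩, ⟨y, interF_mono h y.2⟩) θ *
          Real.exp (∑ e : interF L' × interF L', coupling L β (e.1, e.2) * cosDiff e θ)) /
      ∫ θ : interF L' → Ang,
        Real.exp (∑ e : interF L' × interF L', coupling L β (e.1, e.2) * cosDiff e θ) := by
  let f : interF L → interF L' := fun k => ⟨k, interF_mono h k.2⟩
  have hf : Function.Injective f := fun k l hkl => Subtype.ext (congrArg (fun k => k.1) hkl)
  let H : (interF L → Ang) → ℝ := fun θ =>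
    ∑ e : interF L × interF L, coupling L β (e.1, e.2) * cosDiff e θ
  have hH : Continuous H := by fun_prop
  have hHf (θ : interF L' → Ang) :
      ∑ e : interF L' × interF L', coupling L β (e.1, e.2) * cosDiff e θ = H (θ ∘ f) := by
    refine (Fintype.sum_of_injective (Prod.map f f) (hf.prodMap hf) _ _ ?_ fun _ => rfl).symm
    rintro ⟨k, l⟩ hkl
    have : ¬ ((k : Site) ∈ interF L ∧ (l : Site) ∈ interF L ∧ adj k l) := fun hc =>
      hkl ⟨(⟨k, hc.1⟩, ⟨l, hc.2.1⟩), rfl⟩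
    simp [coupling, this]
  have hE (θ : Cfg L) : energy0 L β θ = H fun i => (θ i : Ang) := by
    simp only [energy0, H, Fintype.sum_prod_type, Finset.mul_sum, coupling]
    refine Finset.sum_congr rfl fun k _ => Finset.sum_congr rfl fun l _ => ?_
    have : cosDiff (k, l) (fun i => (θ i : Ang)) = Real.cos (θ k - θ l) := by
      rw [← toCircle_coe_re]
      rfl
    simp [this]
  have hC (θ : Cfg L) : Real.cos (val L θ x - val L θ y) =
      cosDiff (x, y) fun i => (θ i : Ang) := by
    rw [val, val, dif_pos x.2, dif_pos y.2, ← toCircle_coe_re]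
    rfl
  obtain ⟨r, hr, hint⟩ := integral_torus_comp hf
  have hnum := hint (fun θ => cosDiff (x, y) θ * Real.exp (H θ)) (by fun_prop)
  have hden := hint (fun θ => Real.exp (H θ)) (by fun_prop)
  have hnum' := setIntegral_cube_eq_integral_torus
    (F := fun θ : interF L → Ang => cosDiff (x, y) θ * Real.exp (H θ)) (by fun_prop)
  have hden' := setIntegral_cube_eq_integral_torus
    (F := fun θ : interF L → Ang => Real.exp (H θ)) (by fun_prop)
  simp only [hHf]
  change _ = (∫ θ : interF L' → Ang, cosDiff (x, y) (θ ∘ f) * Real.exp (H (θ ∘ f))) / _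
  rw [hnum, hden, mul_div_mul_left _ _ hr, ← hnum', ← hden']
  simp only [corr0, avg0, hE, hC]
  rfl

/-- The free-boundary two-point function is nondecreasing in the volume. -/
theorem corr0_monotone_in_volume
    (β : ℝ) (hβ : 0 < β) (x y : Site) (L L' : ℕ)
    (hL : max (supNorm x) (supNorm y) < (L : ℤ)) (hLL' : L ≤ L') :
    corr0 L β x y ≤ corr0 L' β x y := by
  have hx := mem_interF (max_lt_iff.1 hL).1
  have hy := mem_interF (max_lt_iff.1 hL).2
  rw [corr0_eq_integral_torus hLL' β ⟨x, hx⟩ ⟨y, hy⟩,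
    corr0_eq_integral_torus le_rfl β ⟨x, interF_mono hLL' hx⟩ ⟨y, interF_mono hLL' hy⟩]
  have hpos {g : (interF L' → Ang) → ℝ} (hg : Continuous g) : 0 < ∫ θ, Real.exp (g θ) := by
    have hc : Continuous fun θ => Real.exp (g θ) := by fun_prop
    exact hc.integral_pos_of_hasCompactSupport_nonneg_nonzero
      (HasCompactSupport.of_compactSpace _) (fun _ => (Real.exp_pos _).le)
      (Real.exp_pos (g 0)).ne'
  rw [div_le_div_iff₀ (hpos (by fun_prop)) (hpos (by fun_prop))]
  refine ginibre_mono volume surjective_add_self_ang (cosDiff (ι := interF L')) sinDiff cosDiff_add cosDiff_sub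
    (fun e => coupling L β (e.1, e.2)) (fun e => coupling L' β (e.1, e.2))
    (fun e => ?_) (fun e => ?_) (⟨x, interF_mono hLL' hx⟩, ⟨y, interF_mono hLL' hy⟩)
  · unfold coupling
    split_ifs <;> positivity
  · unfold coupling
    split_ifs with h₁ h₂
    · exact le_rfl
    · exact absurd ⟨interF_mono hLL' h₁.1, interF_mono hLL' h₁.2.1, h₁.2.2⟩ h₂
    · positivity
    · exact le_rfl
end
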